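/- arXiv:2211.04885 — 2 statements merged into one kernel-verified Lean document; each statement's English description precedes it below -/
import Mathlib

section
/- Let d ≥ 2, s ∈ (0,1), p ≥ 1, α ∈ ℝ, Λ > 1. There exists C > 0 depending only on d, s, p, α, Λ such that for every radial function u ∈ L¹_loc(ℝ^d \ {0}), writing û(r) = u(rσ) for σ ∈ S^{d-1}, one has ∫₀^∞ ∫₀^∞ |û(r₁) − û(r₂)|^p r₁^{αp + d−1} χ_Λ(r₁, r₂) / |r₁ − r₂|^{1+sp} dr₁ dr₂ ≤ C ∫_{ℝ^d} ∫_{ℝ^d} |u(x) − u(y)|^p |x|^{αp} χ_Λ(|x|,|y|) / |x−y|^{d+sp} dx dy, where χ_Λ(r₁,r₂) = 1 if Λ^{-1} r₁ ≤ r₂ ≤ Λ r₁ and 0 otherwise. -/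
open MeasureTheory ENNReal Set

/-- The cutoff `χ_Λ(r₁, r₂)`, equal to `1` when `Λ⁻¹ r₁ ≤ r₂ ≤ Λ r₁` and `0` otherwise. -/
noncomputable def chiCut (Λ r₁ r₂ : ℝ) : ℝ :=
  if Λ⁻¹ * r₁ ≤ r₂ ∧ r₂ ≤ Λ * r₁ then 1 else 0


lemma rg_polar {d : ℕ} (hd : 2 ≤ d) (f : EuclideanSpace ℝ (Fin d) → ℝ≥0∞) (hf : Measurable f) :
    ∫⁻ x, f x = ∫⁻ ω : Metric.sphere (0 : EuclideanSpace ℝ (Fin d)) 1, (∫⁻ r in Ioi (0:ℝ),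
      ENNReal.ofReal (r ^ (d-1)) * f (r • (ω : EuclideanSpace ℝ (Fin d))))
      ∂(volume : Measure (EuclideanSpace ℝ (Fin d))).toSphere := by
  have : Nontrivial (EuclideanSpace ℝ (Fin d)) := by
    have : Nonempty (Fin d) := ⟨⟨0, by omega⟩⟩
    infer_instance
  set μ : Measure (EuclideanSpace ℝ (Fin d)) := volume with hμ
  have key := μ.measurePreserving_homeomorphUnitSphereProd
  calc ∫⁻ x, f x ∂μ = ∫⁻ x : ({(0)}ᶜ : Set (EuclideanSpace ℝ (Fin d))), f x ∂(μ.comap (↑)) := by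
        rw [lintegral_subtype_comap (measurableSet_singleton _).compl f, restrict_compl_singleton]
    _ = ∫⁻ z, f ((homeomorphUnitSphereProd (EuclideanSpace ℝ (Fin d))).symm z)
          ∂μ.toSphere.prod (.volumeIoiPow (Module.finrank ℝ (EuclideanSpace ℝ (Fin d)) - 1)) := by
        rw [← key.lintegral_comp_emb (Homeomorph.measurableEmbedding _)]
        simp
    _ = _ := by
        rw [lintegral_prod]
        · refine lintegral_congr fun ω => ?_
          rw [Measure.volumeIoiPow, lintegral_withDensity_eq_lintegral_mul]
          · simp only [Pi.mul_apply, homeomorphUnitSphereProd_symm_apply_coe, finrank_euclideanSpace_fin]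
            exact lintegral_subtype_comap measurableSet_Ioi (fun r : ℝ => ENNReal.ofReal (r ^ (d-1)) *
              f (r • (ω : EuclideanSpace ℝ (Fin d))))
          · fun_prop
          · simp only [homeomorphUnitSphereProd_symm_apply_coe]
            fun_prop
        · simp only [homeomorphUnitSphereProd_symm_apply_coe]
          fun_prop

lemma rg_tube {d : ℕ} (w : EuclideanSpace ℝ (Fin d)) (hw : ‖w‖ = 1)
    (ρ : ℝ) (hρ : 0 < ρ) (S : Set (EuclideanSpace ℝ (Fin d)))
    (hS : ∀ a ∈ Ioo (1/4:ℝ) (1/2), Metric.ball (a • w) ρ ⊆ S) :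
    ENNReal.ofReal (1/4) * (ENNReal.ofReal (ρ ^ d) *
      volume (Metric.ball (0 : EuclideanSpace ℝ (Fin d)) 1)) ≤
      ENNReal.ofReal (2 * ρ) * volume S := by
  set T : Set (EuclideanSpace ℝ (Fin d)) := ⋃ a ∈ Ioo (1/4:ℝ) (1/2), Metric.ball (a • w) ρ with hT
  have hTo : IsOpen T := isOpen_biUnion fun _ _ => Metric.isOpen_ball
  have hTS : T ⊆ S := iUnion₂_subset hS
  refine le_trans ?_ (mul_le_mul_right (measure_mono hTS) _)
  let P : Set (ℝ × EuclideanSpace ℝ (Fin d)) := {z | z.1 ∈ Ioo (1/4:ℝ) (1/2) ∧ dist z.2 (z.1 • w) < ρ}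
  have hP : MeasurableSet P := by
    apply IsOpen.measurableSet
    apply IsOpen.inter
    · exact isOpen_Ioo.preimage continuous_fst
    · exact isOpen_lt (f := fun z : ℝ × EuclideanSpace ℝ (Fin d) => dist z.2 (z.1 • w))
        (g := fun _ => ρ) (by fun_prop) (by fun_prop)
  have h1 := Measure.prod_apply (μ := (volume : Measure ℝ))
    (ν := (volume : Measure (EuclideanSpace ℝ (Fin d)))) hP
  have h2 := Measure.prod_apply_symm (μ := (volume : Measure ℝ))
    (ν := (volume : Measure (EuclideanSpace ℝ (Fin d)))) hP
  calc _ = ∫⁻ a in Ioo (1/4:ℝ) (1/2), volume (Metric.ball (a • w) ρ) := by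
        simp_rw [Measure.addHaar_ball_of_pos volume _ hρ]
        rw [setLIntegral_const, Real.volume_Ioo, mul_comm]
        norm_num
    _ ≤ ∫⁻ a, volume (Prod.mk a ⁻¹' P) := by
        rw [← lintegral_indicator measurableSet_Ioo]
        refine lintegral_mono fun a => ?_
        by_cases ha : a ∈ Ioo (1/4:ℝ) (1/2)
        · rw [indicator_of_mem ha]
          refine measure_mono fun y hy => ⟨ha, hy⟩
        · rw [indicator_of_notMem ha]; exact zero_le
    _ = ∫⁻ y, volume ((fun a => (a, y)) ⁻¹' P) := by rw [← h1, h2]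
    _ ≤ ∫⁻ y, T.indicator (fun _ => ENNReal.ofReal (2 * ρ)) y := by
        refine lintegral_mono fun y => ?_
        by_cases hy : y ∈ T
        · rw [indicator_of_mem hy]
          have : ((fun a => (a, y)) ⁻¹' P) ⊆ Metric.ball (inner ℝ y w) ρ := by
            intro a ha
            have h : dist y (a • w) < ρ := ha.2
            rw [Metric.mem_ball, dist_comm, Real.dist_eq]
            refine lt_of_le_of_lt ?_ h
            have e : inner ℝ y w - a = inner ℝ (y - a • w) w := by
              rw [inner_sub_left, inner_smul_left, real_inner_self_eq_norm_sq, hw]; simp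
            rw [e, dist_eq_norm]
            simpa [hw] using abs_real_inner_le_norm (y - a • w) w
          refine (measure_mono this).trans ?_
          rw [Real.volume_ball]
        · rw [indicator_of_notMem hy]
          have : ((fun a => (a, y)) ⁻¹' P) = ∅ := by
            ext a
            simp only [mem_preimage, mem_empty_iff_false, iff_false]
            intro ha
            exact hy (mem_iUnion₂.2 ⟨a, ha.1, ha.2⟩)
          rw [this]; simp
    _ = _ := by rw [lintegral_indicator hTo.measurableSet, setLIntegral_const]

open scoped Pointwise in
lemma rg_cap {d : ℕ} (hd : 2 ≤ d) (Λ : ℝ) (hΛ : 1 < Λ) :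
    ∃ c : ℝ, 0 < c ∧ ∀ (w : EuclideanSpace ℝ (Fin d)), ‖w‖ = 1 → ∀ t : ℝ, 0 < t → t ≤ Λ →
      ENNReal.ofReal (c * t ^ (d-1)) ≤ (volume : Measure (EuclideanSpace ℝ (Fin d))).toSphere
        {ω | ‖(ω : EuclideanSpace ℝ (Fin d)) - w‖ < t} := by
  have hB0 : volume (Metric.ball (0 : EuclideanSpace ℝ (Fin d)) 1) ≠ 0 :=
    (Metric.measure_ball_pos _ _ one_pos).ne'
  have hBt : volume (Metric.ball (0 : EuclideanSpace ℝ (Fin d)) 1) ≠ ⊤ := measure_ball_lt_top.ne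
  set B := (volume (Metric.ball (0 : EuclideanSpace ℝ (Fin d)) 1)).toReal with hB
  have hBp : 0 < B := ENNReal.toReal_pos hB0 hBt
  have hBe : volume (Metric.ball (0 : EuclideanSpace ℝ (Fin d)) 1) = ENNReal.ofReal B :=
    (ENNReal.ofReal_toReal hBt).symm
  refine ⟨B / 8 * (1 / (16 * Λ)) ^ (d-1), by positivity, fun w hw t ht htΛ => ?_⟩
  have hm : MeasurableSet {ω : Metric.sphere (0 : EuclideanSpace ℝ (Fin d)) 1 |
      ‖(ω : EuclideanSpace ℝ (Fin d)) - w‖ < t} :=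
    (isOpen_lt (by fun_prop) (by fun_prop)).measurableSet
  rw [Measure.toSphere_apply' _ hm]
  set ρ := t / (16 * Λ) with hρd
  have hρ : 0 < ρ := by positivity
  have hρ1 : ρ ≤ 1/16 := by
    rw [hρd, div_le_iff₀ (by positivity)]; linarith
  have hρt : 16 * ρ < t := by
    have : 16 * ρ = t / Λ := by rw [hρd]; field_simp
    rw [this, div_lt_iff₀ (by positivity)]
    nlinarith
  have key := rg_tube w hw ρ hρ (Ioo (0:ℝ) 1 • (Subtype.val '' {ω : Metric.sphere (0 : EuclideanSpace ℝ (Fin d)) 1 |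
      ‖(ω : EuclideanSpace ℝ (Fin d)) - w‖ < t})) (by
    intro a ha y hy
    rw [Metric.mem_ball, dist_eq_norm] at hy
    have haw : ‖a • w‖ = a := by rw [norm_smul, hw, Real.norm_eq_abs, abs_of_pos (by linarith [ha.1])]; ring
    have h1 : |‖y‖ - a| < ρ := by
      have := abs_norm_sub_norm_le y (a • w)
      rw [haw] at this; linarith
    have h1' := abs_lt.1 h1
    have hy0 : 1/8 < ‖y‖ := by linarith [ha.1]
    have hy1 : ‖y‖ < 1 := by linarith [ha.2]
    have hyp : 0 < ‖y‖ := by linarith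
    refine ⟨‖y‖, ⟨hyp, hy1⟩, ‖y‖⁻¹ • y, ⟨⟨‖y‖⁻¹ • y, ?_⟩, ?_, rfl⟩, ?_⟩
    · simp [norm_smul, hyp.ne']
    · show ‖‖y‖⁻¹ • y - w‖ < t
      have e : ‖y‖⁻¹ • y - w = ‖y‖⁻¹ • ((y - a • w) + (a - ‖y‖) • w) := by
        have : w = ‖y‖⁻¹ • ‖y‖ • w := by rw [smul_smul, inv_mul_cancel₀ hyp.ne', one_smul]
        nth_rw 1 [this]
        rw [← smul_sub]; congr 1; module
      rw [e, norm_smul, norm_inv, norm_norm, inv_mul_lt_iff₀ hyp]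
      have : ‖(y - a • w) + (a - ‖y‖) • w‖ ≤ ρ + ρ := by
        refine (norm_add_le _ _).trans (add_le_add hy.le ?_)
        rw [norm_smul, hw, Real.norm_eq_abs, abs_sub_comm]; linarith
      nlinarith
    · show ‖y‖ • ‖y‖⁻¹ • y = y
      rw [smul_smul, mul_inv_cancel₀ hyp.ne', one_smul])
  set V := volume (Ioo (0:ℝ) 1 • (Subtype.val '' {ω : Metric.sphere (0 : EuclideanSpace ℝ (Fin d)) 1 |
      ‖(ω : EuclideanSpace ℝ (Fin d)) - w‖ < t}) : Set (EuclideanSpace ℝ (Fin d))) with hV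
  have h2 : ENNReal.ofReal (2 * ρ) * ENNReal.ofReal (B / 8 * ρ ^ (d-1)) ≤ ENNReal.ofReal (2 * ρ) * V := by
    refine le_trans (le_of_eq ?_) key
    rw [hBe, ← ENNReal.ofReal_mul (by positivity), ← ENNReal.ofReal_mul (by positivity),
      ← ENNReal.ofReal_mul (by positivity)]
    congr 1
    obtain ⟨k, rfl⟩ : ∃ k, d = k + 1 := ⟨d-1, by omega⟩
    simp only [Nat.add_sub_cancel]
    ring
  have h3 : ENNReal.ofReal (B / 8 * ρ ^ (d-1)) ≤ V :=
    (ENNReal.mul_le_mul_iff_right (by simpa using hρ) ENNReal.ofReal_ne_top).1 h2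
  calc _ = ENNReal.ofReal (B / 8 * ρ ^ (d-1)) := by
        congr 1; rw [hρd, div_eq_mul_one_div t, mul_pow]; ring
    _ ≤ 1 * V := by simpa using h3
    _ ≤ _ := by
        gcongr
        rw [finrank_euclideanSpace_fin]
        exact_mod_cast (by omega : 1 ≤ d)

lemma rg_inner {d : ℕ} (hd : 2 ≤ d) (Λ q : ℝ) (hΛ : 1 < Λ) (hq : 0 < q) :
    ∃ c : ℝ, 0 < c ∧ ∀ (x : EuclideanSpace ℝ (Fin d)), x ≠ 0 → ∀ h : ℝ → ℝ≥0∞, Measurable h →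
      (∀ r, ‖x‖ > Λ * r → h r = 0) →
      ENNReal.ofReal c * ∫⁻ r in Ioi (0:ℝ), h r * ENNReal.ofReal (1 / |‖x‖ - r| ^ (1 + q)) ≤
        ∫⁻ y : EuclideanSpace ℝ (Fin d), h ‖y‖ * ENNReal.ofReal (1 / ‖x - y‖ ^ ((d:ℝ) + q)) := by
  obtain ⟨c, hc, hcap⟩ := rg_cap hd Λ hΛ
  refine ⟨c / 2 ^ ((d:ℝ) + q), by positivity, fun x hx h hh hsupp => ?_⟩
  rw [rg_polar hd _ (by fun_prop), lintegral_lintegral_swap (by fun_prop),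
    ← lintegral_const_mul _ (by fun_prop)]
  refine setLIntegral_mono' measurableSet_Ioi fun r (hr : 0 < r) => ?_
  have hxp : 0 < ‖x‖ := norm_pos_iff.2 hx
  by_cases h0 : ‖x‖ > Λ * r
  · simp [hsupp r h0]
  by_cases h1 : ‖x‖ = r
  · have : (1 + q) ≠ 0 := by positivity
    simp [h1, Real.zero_rpow this]
  push Not at h0
  set δ := |‖x‖ - r| with hδ
  have hδp : 0 < δ := abs_pos.2 (sub_ne_zero.2 h1)
  have hδΛ : δ / r ≤ Λ := by
    rw [div_le_iff₀ hr, hδ, abs_le]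
    constructor <;> nlinarith
  set w := ‖x‖⁻¹ • x with hw
  have hwn : ‖w‖ = 1 := by simp [hw, norm_smul, hxp.ne']
  have hxw : x = ‖x‖ • w := by rw [hw, smul_smul, mul_inv_cancel₀ hxp.ne', one_smul]
  have hcap' := hcap w hwn (δ / r) (by positivity) hδΛ
  set S : Set (Metric.sphere (0 : EuclideanSpace ℝ (Fin d)) 1) :=
    {ω | ‖(ω : EuclideanSpace ℝ (Fin d)) - w‖ < δ / r} with hS
  have hm : MeasurableSet S := (isOpen_lt (by fun_prop) (by fun_prop)).measurableSet
  have hnr : ∀ ω : Metric.sphere (0 : EuclideanSpace ℝ (Fin d)) 1,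
      ‖r • (ω : EuclideanSpace ℝ (Fin d))‖ = r := by
    intro ω
    rw [norm_smul, norm_eq_of_mem_sphere, Real.norm_eq_abs, abs_of_pos hr, mul_one]
  simp only [hnr]
  calc _ = h r * (ENNReal.ofReal (r ^ (d-1)) * (ENNReal.ofReal (1 / (2 * δ) ^ ((d:ℝ) + q)) *
        ENNReal.ofReal (c * (δ / r) ^ (d-1)))) := by
        rw [mul_left_comm, ← ENNReal.ofReal_mul (by positivity), ← ENNReal.ofReal_mul (by positivity),
          ← ENNReal.ofReal_mul (by positivity)]
        congr 2
        rw [Real.mul_rpow (by norm_num) hδp.le]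
        have e : δ ^ ((d:ℝ) + q) = δ ^ (d-1) * δ ^ (1 + q) := by
          rw [← Real.rpow_natCast δ (d-1), ← Real.rpow_add hδp]
          congr 1
          rw [Nat.cast_sub (by omega)]; push_cast; ring
        rw [e, div_pow]
        field_simp
    _ ≤ h r * (ENNReal.ofReal (r ^ (d-1)) * (ENNReal.ofReal (1 / (2 * δ) ^ ((d:ℝ) + q)) *
        (volume : Measure (EuclideanSpace ℝ (Fin d))).toSphere S)) := by gcongr
    _ = ∫⁻ ω in S, ENNReal.ofReal (r ^ (d-1)) * (h r * ENNReal.ofReal (1 / (2 * δ) ^ ((d:ℝ) + q)))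
          ∂(volume : Measure (EuclideanSpace ℝ (Fin d))).toSphere := by
        rw [setLIntegral_const]; ring
    _ ≤ ∫⁻ ω in S, ENNReal.ofReal (r ^ (d-1)) * (h r * ENNReal.ofReal
          (1 / ‖x - r • (ω : EuclideanSpace ℝ (Fin d))‖ ^ ((d:ℝ) + q)))
          ∂(volume : Measure (EuclideanSpace ℝ (Fin d))).toSphere := by
        refine setLIntegral_mono' hm fun ω hω => ?_
        have hlow : 0 < ‖x - r • (ω : EuclideanSpace ℝ (Fin d))‖ := by
          have := abs_norm_sub_norm_le x (r • (ω : EuclideanSpace ℝ (Fin d)))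
          rw [hnr] at this
          linarith
        have hup : ‖x - r • (ω : EuclideanSpace ℝ (Fin d))‖ ≤ 2 * δ := by
          have e : x - r • (ω : EuclideanSpace ℝ (Fin d)) =
              (‖x‖ - r) • w - r • ((ω : EuclideanSpace ℝ (Fin d)) - w) := by
            nth_rw 1 [hxw]; module
          rw [e]
          refine (norm_sub_le _ _).trans ?_
          rw [norm_smul _ w, norm_smul r, hwn, Real.norm_eq_abs, Real.norm_eq_abs, abs_of_pos hr]
          have : ‖(ω : EuclideanSpace ℝ (Fin d)) - w‖ < δ / r := hω
          rw [lt_div_iff₀ hr] at this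
          linarith
        gcongr
    _ ≤ _ := setLIntegral_le_lintegral _ _

lemma rg_meas {d : ℕ} (hd : 2 ≤ d) (u : EuclideanSpace ℝ (Fin d) → ℝ)
    (hu : ∀ x y : EuclideanSpace ℝ (Fin d), ‖x‖ = ‖y‖ → u x = u y)
    (hl : LocallyIntegrableOn u {(0 : EuclideanSpace ℝ (Fin d))}ᶜ volume)
    (σ : EuclideanSpace ℝ (Fin d)) (hσ : ‖σ‖ = 1) :
    ∃ v : ℝ → ℝ, Measurable v ∧ (∀ᵐ r ∂(volume.restrict (Ioi (0:ℝ))), u (r • σ) = v r) ∧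
      ∀ᵐ x : EuclideanSpace ℝ (Fin d), u x = v ‖x‖ := by
  have hne : Nontrivial (EuclideanSpace ℝ (Fin d)) := by
    have : Nonempty (Fin d) := ⟨⟨0, by omega⟩⟩
    infer_instance
  have hm : AEMeasurable u (volume : Measure (EuclideanSpace ℝ (Fin d))) := by
    have := hl.aestronglyMeasurable
    rw [restrict_compl_singleton] at this
    exact this.aemeasurable
  set g := hm.mk u with hg
  have hgm : Measurable g := hm.measurable_mk
  obtain ⟨N, hN, hNm, hN0⟩ := exists_measurable_superset_of_null (ae_iff.1 hm.ae_eq_mk)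
  have hpos : ∀ r : ℝ, 0 < r → ENNReal.ofReal (r ^ (d-1)) ≠ 0 := by
    intro r hr
    have : 0 < r ^ (d-1) := by positivity
    simpa using this
  have h1 : ∫⁻ x, N.indicator (fun _ => (1:ℝ≥0∞)) x = 0 := by
    rw [lintegral_indicator hNm]; simp [hN0]
  have hI : Measurable (N.indicator (fun _ => (1:ℝ≥0∞))) := measurable_const.indicator hNm
  rw [rg_polar hd _ hI, lintegral_eq_zero_iff (by fun_prop)] at h1
  have : (ae (volume : Measure (EuclideanSpace ℝ (Fin d))).toSphere).NeBot := by
    rw [ae_neBot]; exact Measure.toSphere_ne_zero _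
  obtain ⟨ω, hω⟩ := h1.exists
  simp only [Pi.zero_apply] at hω
  rw [lintegral_eq_zero_iff (by fun_prop)] at hω
  have hv : ∀ᵐ r ∂(volume.restrict (Ioi (0:ℝ))), u (r • σ) = g (r • (ω : EuclideanSpace ℝ (Fin d))) := by
    filter_upwards [hω, ae_restrict_mem measurableSet_Ioi] with r hr (hr0 : 0 < r)
    have hz := (mul_eq_zero.1 hr).resolve_left (hpos r hr0)
    have hnot : r • (ω : EuclideanSpace ℝ (Fin d)) ∉ N := by
      intro hmem
      simp [indicator_of_mem hmem] at hz
    rw [hu (r • σ) (r • (ω : EuclideanSpace ℝ (Fin d))) (by simp [norm_smul, hσ])]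
    by_contra hcon
    exact hnot (hN hcon)
  refine ⟨fun r => g (r • (ω : EuclideanSpace ℝ (Fin d))), by fun_prop, hv, ?_⟩
  obtain ⟨M, hM, hMm, hM0⟩ := exists_measurable_superset_of_null (ae_iff.1 hv)
  have hJ : Measurable (M.indicator (fun _ => (1:ℝ≥0∞))) := measurable_const.indicator hMm
  have h2 : ∫⁻ x : EuclideanSpace ℝ (Fin d), M.indicator (fun _ => (1:ℝ≥0∞)) ‖x‖ = 0 := by
    rw [rg_polar hd _ (by fun_prop)]
    refine (lintegral_congr fun ω' => ?_).trans lintegral_zero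
    rw [lintegral_eq_zero_iff (by fun_prop)]
    have : ∀ᵐ r ∂(volume.restrict (Ioi (0:ℝ))), r ∉ M := by
      rw [ae_iff]; simpa using hM0
    filter_upwards [this, ae_restrict_mem measurableSet_Ioi] with r hr (hr0 : 0 < r)
    have e : ‖r • (ω' : EuclideanSpace ℝ (Fin d))‖ = r := by
      rw [norm_smul, norm_eq_of_mem_sphere, Real.norm_eq_abs, abs_of_pos hr0, mul_one]
    simp [e, hr]
  rw [lintegral_eq_zero_iff (by fun_prop)] at h2
  filter_upwards [h2] with x hx
  have hnot : ‖x‖ ∉ M := by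
    intro hmem
    simp [indicator_of_mem hmem] at hx
  rw [hu x (‖x‖ • σ) (by simp [norm_smul, hσ])]
  by_contra hcon
  exact hnot (hM hcon)

lemma rg_chi (Λ : ℝ) : Measurable (fun z : ℝ × ℝ => chiCut Λ z.1 z.2) := by
  unfold chiCut
  refine Measurable.ite ?_ measurable_const measurable_const
  have h1 : MeasurableSet {z : ℝ × ℝ | Λ⁻¹ * z.1 ≤ z.2} :=
    measurableSet_le (by fun_prop) (by fun_prop)
  have h2 : MeasurableSet {z : ℝ × ℝ | z.2 ≤ Λ * z.1} :=
    measurableSet_le (by fun_prop) (by fun_prop)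
  exact h1.inter h2

lemma rg_chi_nonneg (Λ a b : ℝ) : 0 ≤ chiCut Λ a b := by
  unfold chiCut; split_ifs <;> norm_num

theorem radial_gagliardo_polar_lower_bound
    (d : ℕ) (s p α Λ : ℝ) (hd : 2 ≤ d) (hs : 0 < s) (hs1 : s < 1) (hp : 1 ≤ p)
    (hΛ : 1 < Λ) :
    ∃ C > (0 : ℝ), ∀ u : EuclideanSpace ℝ (Fin d) → ℝ,
      (∀ x y : EuclideanSpace ℝ (Fin d), ‖x‖ = ‖y‖ → u x = u y) →
      LocallyIntegrableOn u {(0 : EuclideanSpace ℝ (Fin d))}ᶜ volume →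
      ∀ σ : EuclideanSpace ℝ (Fin d), ‖σ‖ = 1 →
      (∫⁻ r₁ in Ioi (0 : ℝ), ∫⁻ r₂ in Ioi (0 : ℝ),
          ENNReal.ofReal (|u (r₁ • σ) - u (r₂ • σ)| ^ p * r₁ ^ (α * p + (d - 1 : ℝ)) *
            chiCut Λ r₁ r₂ / |r₁ - r₂| ^ (1 + s * p))) ≤
        ENNReal.ofReal C *
          ∫⁻ x : EuclideanSpace ℝ (Fin d), ∫⁻ y : EuclideanSpace ℝ (Fin d),
            ENNReal.ofReal (|u x - u y| ^ p * ‖x‖ ^ (α * p) *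
              chiCut Λ ‖x‖ ‖y‖ / ‖x - y‖ ^ ((d : ℝ) + s * p)) := by
  have hne : Nontrivial (EuclideanSpace ℝ (Fin d)) := by
    have : Nonempty (Fin d) := ⟨⟨0, by omega⟩⟩
    infer_instance
  obtain ⟨c, hc, hin⟩ := rg_inner hd Λ (s * p) hΛ (by positivity)
  set A := (volume : Measure (EuclideanSpace ℝ (Fin d))).toSphere univ with hA
  have hA0 : A ≠ 0 := by
    rw [hA, Ne, Measure.measure_univ_eq_zero]; exact Measure.toSphere_ne_zero _
  have hAt : A ≠ ⊤ := measure_ne_top _ _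
  have hAp : 0 < A.toReal := ENNReal.toReal_pos hA0 hAt
  refine ⟨1 / (c * A.toReal), by positivity, fun u hu hl σ hσ => ?_⟩
  obtain ⟨v, hv, hv1, hv2⟩ := rg_meas hd u hu hl σ hσ
  let h : ℝ × ℝ → ℝ≥0∞ := fun z =>
    ENNReal.ofReal (|v z.1 - v z.2| ^ p * z.1 ^ (α * p) * chiCut Λ z.1 z.2)
  have hh : Measurable h := by
    have := rg_chi Λ
    fun_prop
  let Φ : ℝ → ℝ≥0∞ := fun r₁ => ∫⁻ r₂ in Ioi (0 : ℝ),
    h (r₁, r₂) * ENNReal.ofReal (1 / |r₁ - r₂| ^ (1 + s * p))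
  have hΦ : Measurable Φ := by
    apply Measurable.lintegral_prod_right'
      (f := fun z : ℝ × ℝ => h (z.1, z.2) * ENNReal.ofReal (1 / |z.1 - z.2| ^ (1 + s * p)))
    fun_prop
  have hL : (∫⁻ r₁ in Ioi (0 : ℝ), ∫⁻ r₂ in Ioi (0 : ℝ),
          ENNReal.ofReal (|u (r₁ • σ) - u (r₂ • σ)| ^ p * r₁ ^ (α * p + (d - 1 : ℝ)) *
            chiCut Λ r₁ r₂ / |r₁ - r₂| ^ (1 + s * p))) =
      ∫⁻ r in Ioi (0:ℝ), ENNReal.ofReal (r ^ (d-1)) * Φ r := by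
    refine lintegral_congr_ae ?_
    filter_upwards [hv1, ae_restrict_mem measurableSet_Ioi] with r₁ hr₁ (hr0 : 0 < r₁)
    rw [← lintegral_const_mul _ (by fun_prop)]
    refine lintegral_congr_ae ?_
    filter_upwards [hv1] with r₂ hr₂
    rw [hr₁, hr₂]
    have := rg_chi_nonneg Λ r₁ r₂
    simp only [h]
    rw [← ENNReal.ofReal_mul (by positivity), ← ENNReal.ofReal_mul (by positivity)]
    congr 1
    have e : r₁ ^ (α * p + (d - 1 : ℝ)) = r₁ ^ (α * p) * r₁ ^ (d-1) := by
      rw [Real.rpow_add hr0, ← Real.rpow_natCast r₁ (d-1), Nat.cast_sub (by omega)]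
      simp
    rw [e]; ring
  have hR : (∫⁻ x : EuclideanSpace ℝ (Fin d), ∫⁻ y : EuclideanSpace ℝ (Fin d),
            ENNReal.ofReal (|u x - u y| ^ p * ‖x‖ ^ (α * p) *
              chiCut Λ ‖x‖ ‖y‖ / ‖x - y‖ ^ ((d : ℝ) + s * p))) =
      ∫⁻ x : EuclideanSpace ℝ (Fin d), ∫⁻ y : EuclideanSpace ℝ (Fin d),
        h (‖x‖, ‖y‖) * ENNReal.ofReal (1 / ‖x - y‖ ^ ((d : ℝ) + s * p)) := by
    refine lintegral_congr_ae ?_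
    filter_upwards [hv2] with x hx
    refine lintegral_congr_ae ?_
    filter_upwards [hv2] with y hy
    rw [hx, hy]
    have := rg_chi_nonneg Λ ‖x‖ ‖y‖
    simp only [h]
    rw [← ENNReal.ofReal_mul (by positivity)]
    congr 1
    ring
  have hlow : ENNReal.ofReal c * (A * ∫⁻ r in Ioi (0:ℝ), ENNReal.ofReal (r ^ (d-1)) * Φ r) ≤
      ∫⁻ x : EuclideanSpace ℝ (Fin d), ∫⁻ y : EuclideanSpace ℝ (Fin d),
        h (‖x‖, ‖y‖) * ENNReal.ofReal (1 / ‖x - y‖ ^ ((d : ℝ) + s * p)) := by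
    calc _ = ENNReal.ofReal c * ∫⁻ x : EuclideanSpace ℝ (Fin d), Φ ‖x‖ := by
          rw [rg_polar hd _ (by fun_prop)]
          congr 1
          rw [mul_comm, hA, ← lintegral_const]
          refine lintegral_congr fun ω => ?_
          refine setLIntegral_congr_fun measurableSet_Ioi fun r (hr : 0 < r) => ?_
          have e : ‖r • (ω : EuclideanSpace ℝ (Fin d))‖ = r := by
            rw [norm_smul, norm_eq_of_mem_sphere, Real.norm_eq_abs, abs_of_pos hr, mul_one]
          simp only [e]
      _ = ∫⁻ x : EuclideanSpace ℝ (Fin d), ENNReal.ofReal c * Φ ‖x‖ := by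
          rw [lintegral_const_mul _ (by fun_prop)]
      _ ≤ _ := by
          refine lintegral_mono_ae ?_
          have : ∀ᵐ x : EuclideanSpace ℝ (Fin d), x ≠ 0 := by
            rw [ae_iff]; simp
          filter_upwards [this] with x hx
          refine hin x hx (fun r => h (‖x‖, r)) (by fun_prop) fun r hr => ?_
          have hz : chiCut Λ ‖x‖ r = 0 := by
            unfold chiCut
            rw [if_neg]
            rintro ⟨h1, -⟩
            rw [inv_mul_le_iff₀ (by linarith)] at h1
            linarith
          simp [h, hz]
  rw [hL, hR]
  calc _ = ENNReal.ofReal (1 / (c * A.toReal)) * (ENNReal.ofReal c *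
        (A * ∫⁻ r in Ioi (0:ℝ), ENNReal.ofReal (r ^ (d-1)) * Φ r)) := by
        have e : A = ENNReal.ofReal A.toReal := (ENNReal.ofReal_toReal hAt).symm
        rw [← mul_assoc, ← mul_assoc]
        nth_rw 2 [e]
        rw [← ENNReal.ofReal_mul (by positivity), ← ENNReal.ofReal_mul (by positivity)]
        have : 1 / (c * A.toReal) * c * A.toReal = 1 := by field_simp
        rw [this]; simp
    _ ≤ _ := by gcongr
end

section
/- Let d ≥ 1, s ∈ (0,1), p > 1, q ≥ 1, τ ≥ 1, 0 < a ≤ 1, and α, β, γ ∈ ℝ with γ = aσ + (1−a)β. Assume the balance law 1/τ + γ/d = a(1/p + (α−s)/d) + (1−a)(1/q + β/d), that 0 ≤ α − σ, that α − σ ≤ s whenever 1/τ + γ/d = 1/p + (α−s)/d, and that 1/τ + γ/d > 0. Then for Λ > 1 there exists C > 0 such that for every u ∈ L¹_loc(ℝ^d \ {0}) with compact support in ℝ^d, ‖|x|^γ u‖_{L^τ(ℝ^d)} ≤ C ‖u‖_{Ẇ^{s,p,α,Λ}(ℝ^d)}^a ‖|x|^β u‖_{L^q(ℝ^d)}^{1−a}.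 -/
open MeasureTheory ENNReal Set

/-- The truncated weighted Gagliardo seminorm `‖g‖_{Ẇ^{s,p,α,Λ}(ℝ^d)}`. -/
noncomputable def truncGagliardo (d : ℕ) (s p α Λ : ℝ)
    (g : EuclideanSpace ℝ (Fin d) → ℝ) : ℝ≥0∞ :=
  (∫⁻ x : EuclideanSpace ℝ (Fin d), ∫⁻ y : EuclideanSpace ℝ (Fin d),
      ENNReal.ofReal (|g x - g y| ^ p * ‖x‖ ^ (α * p) *
        chiCut Λ ‖x‖ ‖y‖ / ‖x - y‖ ^ ((d : ℝ) + s * p))) ^ (1 / p)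

/-- The weighted norm `‖ |x|^γ v ‖_{L^τ(ℝ^d)}`, valued in `[0,∞]`. -/
noncomputable def weightedLnorm (d : ℕ) (γ τ : ℝ)
    (v : EuclideanSpace ℝ (Fin d) → ℝ) : ℝ≥0∞ :=
  (∫⁻ x : EuclideanSpace ℝ (Fin d), ENNReal.ofReal (‖x‖ ^ (γ * τ) * |v x| ^ τ)) ^ (1 / τ)

lemma ckn_median {X : Type*} [MeasurableSpace X] (μ : Measure X) [IsFiniteMeasure μ] (u : X → ℝ)
    (hu : Measurable u) (M : ℝ) (hM : ∀ x, |u x| ≤ M) :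
    ∃ c : ℝ, μ univ ≤ 2 * μ {x | u x ≤ c} ∧ μ univ ≤ 2 * μ {x | c ≤ u x} := by
  by_cases hV : μ univ = 0
  · exact ⟨0, by simp [hV], by simp [hV]⟩
  have hVf : μ univ ≠ ∞ := measure_ne_top _ _
  set A : Set ℝ := {t | μ univ ≤ 2 * μ {x | t ≤ u x}} with hA
  have hne : -M ∈ A := by
    have : {x | -M ≤ u x} = univ := by
      ext x; simp; linarith [(abs_le.1 (hM x)).1]
    simp only [hA, mem_ofPred_eq, this]
    rw [two_mul]; exact le_self_add
  have hbd : BddAbove A := by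
    refine ⟨M, fun t ht => ?_⟩
    by_contra hlt
    push Not at hlt
    have : {x | t ≤ u x} = ∅ := by
      ext x; simp; linarith [(abs_le.1 (hM x)).2]
    simp only [hA, mem_ofPred_eq, this] at ht
    simp at ht
    exact hV (by simp [ht])
  have hdown : ∀ t ∈ A, ∀ t' ≤ t, t' ∈ A := by
    intro t ht t' htt
    have ht1 : μ univ ≤ 2 * μ {x | t ≤ u x} := ht
    change μ univ ≤ 2 * μ {x | t' ≤ u x}
    refine ht1.trans ?_
    gcongr
  set c := sSup A
  refine ⟨c, ?_, ?_⟩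
  · have hU : {x | c < u x} = ⋃ n : ℕ, {x | c + 1 / ((n : ℝ) + 1) ≤ u x} := by
      ext x
      simp only [mem_ofPred_eq, mem_iUnion]
      constructor
      · intro h
        obtain ⟨n, hn⟩ := exists_nat_one_div_lt (sub_pos.2 h)
        exact ⟨n, by linarith⟩
      · rintro ⟨n, hn⟩
        have : (0 : ℝ) < 1 / ((n : ℝ) + 1) := by positivity
        linarith
    have hmono : Monotone fun n : ℕ => {x | c + 1 / ((n : ℝ) + 1) ≤ u x} := by
      intro n m hnm x hx
      simp only [mem_ofPred_eq] at hx ⊢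
      have : 1 / ((m : ℝ) + 1) ≤ 1 / ((n : ℝ) + 1) := by gcongr
      linarith
    have h1 : 2 * μ {x | c < u x} ≤ μ univ := by
      rw [hU, hmono.measure_iUnion, ENNReal.mul_iSup]
      refine iSup_le fun n => ?_
      by_contra hlt
      push Not at hlt
      have : c + 1 / ((n : ℝ) + 1) ∈ A := hlt.le
      have h2 := le_csSup hbd this
      have : (0 : ℝ) < 1 / ((n : ℝ) + 1) := by positivity
      change c + _ ≤ c at h2
      linarith
    have h2 : μ univ = μ {x | u x ≤ c} + μ {x | c < u x} := by
      rw [← measure_add_measure_compl (measurableSet_le hu measurable_const : MeasurableSet {x | u x ≤ c})]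
      congr 2
      ext x; simp
    have hf1 : μ {x | u x ≤ c} ≠ ∞ := measure_ne_top _ _
    have hf2 : μ {x | c < u x} ≠ ∞ := measure_ne_top _ _
    rw [h2] at h1 ⊢
    lift μ {x | u x ≤ c} to NNReal using hf1 with p
    lift μ {x | c < u x} to NNReal using hf2 with q
    norm_cast at h1 ⊢
    have h1' : (2:ℝ) * q ≤ p + q := by exact_mod_cast h1
    have : (p:ℝ) + q ≤ 2 * p := by linarith
    exact_mod_cast this
  · have hU : {x | c ≤ u x} = ⋂ n : ℕ, {x | c - 1 / ((n : ℝ) + 1) ≤ u x} := by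
      ext x
      simp only [mem_ofPred_eq, mem_iInter]
      constructor
      · intro h n
        have : (0 : ℝ) < 1 / ((n : ℝ) + 1) := by positivity
        linarith
      · intro h
        by_contra hlt
        push Not at hlt
        obtain ⟨n, hn⟩ := exists_nat_one_div_lt (sub_pos.2 hlt)
        linarith [h n]
    have hanti : Antitone fun n : ℕ => {x | c - 1 / ((n : ℝ) + 1) ≤ u x} := by
      intro n m hnm x hx
      simp only [mem_ofPred_eq] at hx ⊢
      have : 1 / ((m : ℝ) + 1) ≤ 1 / ((n : ℝ) + 1) := by gcongr
      linarith
    rw [hU, hanti.measure_iInter (fun n => (measurableSet_le measurable_const hu).nullMeasurableSet)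
      ⟨0, measure_ne_top _ _⟩, ENNReal.mul_iInf_of_ne (by simp) (by simp)]
    refine le_iInf fun n => ?_
    have : (0 : ℝ) < 1 / ((n : ℝ) + 1) := by positivity
    obtain ⟨t, ht, hlt⟩ := exists_lt_of_lt_csSup ⟨_, hne⟩ (show c - 1 / ((n : ℝ) + 1) < c by linarith)
    exact hdown t ht _ hlt.le

/-- lower bound for the kernel integral -/
lemma ckn_lower {d : ℕ} (s p : ℝ) (hs : 0 ≤ s) (hp : 0 < p)
    (D S : Set (EuclideanSpace ℝ (Fin d))) (hS : MeasurableSet S) (hSD : S ⊆ D)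
    (u : EuclideanSpace ℝ (Fin d) → ℝ) (x : EuclideanSpace ℝ (Fin d)) (h ρ v : ℝ) (hh : 0 < h) (hρ : 0 ≤ ρ)
    (h1 : ∀ y ∈ S, h ≤ |u x - u y|) (h2 : ∀ y ∈ S, ‖x - y‖ ≤ ρ)
    (hv : ENNReal.ofReal v ≤ volume S) :
    ENNReal.ofReal (h ^ p / ρ ^ ((d : ℝ) + s * p) * v) ≤
      ∫⁻ y in D, ENNReal.ofReal (|u x - u y| ^ p / ‖x - y‖ ^ ((d : ℝ) + s * p)) := by
  calc ENNReal.ofReal (h ^ p / ρ ^ ((d : ℝ) + s * p) * v)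
      = ENNReal.ofReal (h ^ p / ρ ^ ((d : ℝ) + s * p)) * ENNReal.ofReal v :=
        ENNReal.ofReal_mul (by positivity)
    _ ≤ ENNReal.ofReal (h ^ p / ρ ^ ((d : ℝ) + s * p)) * volume S := by gcongr
    _ = ∫⁻ y in S, ENNReal.ofReal (h ^ p / ρ ^ ((d : ℝ) + s * p)) := (setLIntegral_const _ _).symm
    _ ≤ ∫⁻ y in S, ENNReal.ofReal (|u x - u y| ^ p / ‖x - y‖ ^ ((d : ℝ) + s * p)) := by
        refine setLIntegral_mono' hS fun y hy => ?_
        have hxy : 0 < ‖x - y‖ := by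
          rw [norm_pos_iff, sub_ne_zero]
          rintro rfl
          have := h1 _ hy
          simp at this
          linarith
        have := h1 y hy
        have := h2 y hy
        gcongr
    _ ≤ _ := lintegral_mono_set hSD

lemma ckn_ptwise (d : ℕ) (hd : 1 ≤ d) (s p τ : ℝ) (hs : 0 ≤ s) (hp : 0 < p) (hτ : 0 < τ)
    (c0 δ K : ℝ) (hc0 : 0 < c0) (hδ : 0 < δ) (hK : 0 < K) :
    ∃ κ > (0 : ℝ), ∀ (D : Set (EuclideanSpace ℝ (Fin d))) (L : ℝ), 0 < L → MeasurableSet D →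
      (∀ x ∈ D, ∀ r, 0 < r → r ≤ δ * L → ∃ S ⊆ D, MeasurableSet S ∧ (∀ y ∈ S, ‖x - y‖ ≤ r) ∧
        ENNReal.ofReal (c0 * r ^ (d : ℝ)) ≤ volume S) →
      (∀ x ∈ D, ∀ y ∈ D, ‖x - y‖ ≤ K * L) →
      ∀ (u : EuclideanSpace ℝ (Fin d) → ℝ), Measurable u → ∀ c : ℝ,
      volume D ≤ 2 * volume (D ∩ {x | u x ≤ c}) → volume D ≤ 2 * volume (D ∩ {x | c ≤ u x}) →
      ∀ J : ℝ, 0 < J → ENNReal.ofReal J = ∫⁻ x in D, ENNReal.ofReal (|u x - c| ^ τ) →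
      ∀ x ∈ D, ENNReal.ofReal (κ * |u x - c| ^ (p + τ * s * p / d)) ≤
        ENNReal.ofReal (J ^ (s * p / d)) *
        ∫⁻ y in D, ENNReal.ofReal (|u x - u y| ^ p / ‖x - y‖ ^ ((d : ℝ) + s * p)) := by
  have hd0 : (0 : ℝ) < d := by exact_mod_cast hd
  set κ1 : ℝ := (1/2) ^ p * c0 / 2 with hκ1
  set κ2 : ℝ := c0 * δ ^ (d : ℝ) / 2 / K ^ ((d : ℝ) + s * p) * δ ^ (s * p) with hκ2
  set B : ℝ := 2 ^ (τ + 1) / c0 with hB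
  have hBpos : 0 < B := by positivity
  have hκ1p : 0 < κ1 := by positivity
  have hκ2p : 0 < κ2 := by positivity
  refine ⟨min κ1 κ2 / B ^ (s * p / d), by positivity, ?_⟩
  intro D L hL hD hball hdiam u hu c hm1 hm2 J hJ hJI x hx
  set W := |u x - c| with hW
  rcases (abs_nonneg (u x - c)).eq_or_lt with h0 | hWpos
  · rw [hW, ← h0, Real.zero_rpow (by positivity)]; simp
  change 0 < W at hWpos
  set r : ℝ := (B * J / W ^ τ) ^ (1 / (d : ℝ)) with hr
  have hrpos : 0 < r := by positivity
  have hrd : r ^ (d : ℝ) = B * J / W ^ τ := by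
    rw [hr, ← Real.rpow_mul (by positivity), one_div_mul_cancel hd0.ne', Real.rpow_one]
  -- key bound
  have key : ENNReal.ofReal (min κ1 κ2 * W ^ p / r ^ (s * p)) ≤
      ∫⁻ y in D, ENNReal.ofReal (|u x - u y| ^ p / ‖x - y‖ ^ ((d : ℝ) + s * p)) := by
    by_cases hrL : r ≤ δ * L
    · obtain ⟨S, hSD, hSm, hSr, hSv⟩ := hball x hx r hrpos hrL
      have hTm : MeasurableSet {y | |u y - c| ≤ W / 2} :=
        measurableSet_le (by fun_prop) measurable_const
      have hbad : volume (S \ {y | |u y - c| ≤ W / 2}) ≤ ENNReal.ofReal (c0 * r ^ (d : ℝ) / 2) := by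
        have h1 := meas_ge_le_lintegral_div (μ := volume.restrict D)
          (f := fun x => ENNReal.ofReal (|u x - c| ^ τ)) (by fun_prop)
          (ε := ENNReal.ofReal ((W / 2) ^ τ)) (by simp; positivity) (by simp)
        rw [← hJI, ← ENNReal.ofReal_div_of_pos (by positivity)] at h1
        have h3 : c0 * r ^ (d : ℝ) / 2 = J / (W / 2) ^ τ := by
          rw [hrd, hB, Real.rpow_add (by norm_num), Real.div_rpow hWpos.le (by norm_num), Real.rpow_one]
          field_simp
        rw [h3]
        refine le_trans ?_ h1
        rw [Measure.restrict_apply' hD]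
        refine measure_mono fun y hy => ⟨?_, hSD hy.1⟩
        have := hy.2
        simp only [mem_ofPred_eq, not_le] at this ⊢
        gcongr
      have hv : ENNReal.ofReal (c0 * r ^ (d : ℝ) / 2) ≤ volume (S ∩ {y | |u y - c| ≤ W / 2}) := by
        have h1 := measure_inter_add_sdiff (μ := volume) S hTm
        have h2 : ENNReal.ofReal (c0 * r ^ (d : ℝ) / 2) + ENNReal.ofReal (c0 * r ^ (d : ℝ) / 2) ≤
            volume (S ∩ {y | |u y - c| ≤ W / 2}) + ENNReal.ofReal (c0 * r ^ (d : ℝ) / 2) := by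
          rw [← ENNReal.ofReal_add (by positivity) (by positivity), add_halves]
          refine hSv.trans ?_
          rw [← h1]
          gcongr
        exact (ENNReal.add_le_add_iff_right (by simp)).1 h2
      have := ckn_lower s p hs hp D _ (hSm.inter hTm) (inter_subset_left.trans hSD) u x (W / 2) r _
        (by positivity) hrpos.le (fun y hy => by
          have h1 := hy.2
          simp only [mem_ofPred_eq] at h1
          have h2 : W ≤ |u x - u y| + |u y - c| := by
            rw [hW]; exact abs_sub_le _ _ _
          linarith) (fun y hy => hSr y hy.1) hv
      refine le_trans (ENNReal.ofReal_le_ofReal ?_) this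
      calc min κ1 κ2 * W ^ p / r ^ (s * p) ≤ κ1 * W ^ p / r ^ (s * p) := by
            gcongr; exact min_le_left _ _
        _ = _ := by
            rw [hκ1, Real.rpow_add hrpos, Real.div_rpow hWpos.le (by norm_num), Real.div_rpow (by norm_num) (by norm_num), Real.one_rpow]
            field_simp
    · push Not at hrL
      have hvD : ENNReal.ofReal (c0 * (δ * L) ^ (d : ℝ)) ≤ volume D := by
        obtain ⟨S, hSD, hSm, hSr, hSv⟩ := hball x hx (δ * L) (by positivity) le_rfl
        exact hSv.trans (measure_mono hSD)
      have hhalf : ∀ V : ℝ≥0∞, volume D ≤ 2 * V → ENNReal.ofReal (c0 * (δ * L) ^ (d : ℝ) / 2) ≤ V := by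
        intro V hV
        rw [ENNReal.ofReal_div_of_pos (by norm_num)]
        refine ENNReal.div_le_of_le_mul ?_
        refine (hvD.trans hV).trans_eq ?_
        rw [mul_comm]; congr 1; simp
      have hfin : ENNReal.ofReal (W ^ p / (K * L) ^ ((d : ℝ) + s * p) * (c0 * (δ * L) ^ (d : ℝ) / 2)) ≤
         ∫⁻ y in D, ENNReal.ofReal (|u x - u y| ^ p / ‖x - y‖ ^ ((d : ℝ) + s * p)) := by
        rcases le_total (u x) c with hc | hc
        · refine ckn_lower s p hs hp D _ (hD.inter (measurableSet_le measurable_const hu))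
            inter_subset_left u x W (K * L) _ hWpos (by positivity) (fun y hy => ?_) (fun y hy => hdiam x hx y hy.1)
            (hhalf _ hm2)
          have h1 : c ≤ u y := hy.2
          rw [hW, abs_of_nonpos (by linarith), abs_of_nonpos (by linarith)]; linarith
        · refine ckn_lower s p hs hp D _ (hD.inter (measurableSet_le hu measurable_const))
            inter_subset_left u x W (K * L) _ hWpos (by positivity) (fun y hy => ?_) (fun y hy => hdiam x hx y hy.1)
            (hhalf _ hm1)
          have h1 : u y ≤ c := hy.2
          rw [hW, abs_of_nonneg (by linarith), abs_of_nonneg (by linarith)]; linarith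
      refine le_trans (ENNReal.ofReal_le_ofReal ?_) hfin
      calc min κ1 κ2 * W ^ p / r ^ (s * p) ≤ κ2 * W ^ p / (δ * L) ^ (s * p) := by
            have : (δ * L) ^ (s * p) ≤ r ^ (s * p) := by
              exact Real.rpow_le_rpow (by positivity) hrL.le (by positivity)
            gcongr; exact min_le_right _ _
        _ = _ := by
            rw [hκ2, Real.mul_rpow hK.le hL.le, Real.mul_rpow hδ.le hL.le, Real.mul_rpow hδ.le hL.le,
              Real.rpow_add hL]
            field_simp
  have hrs : r ^ (s * p) = B ^ (s * p / d) * J ^ (s * p / d) / W ^ (τ * s * p / d) := by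
    rw [hr, ← Real.rpow_mul (by positivity), Real.div_rpow (by positivity) (by positivity),
      Real.mul_rpow hBpos.le hJ.le, ← Real.rpow_mul hWpos.le]
    congr 2 <;> ring_nf
  calc ENNReal.ofReal (min κ1 κ2 / B ^ (s * p / d) * W ^ (p + τ * s * p / d))
      = ENNReal.ofReal (J ^ (s * p / d) * (min κ1 κ2 * W ^ p / r ^ (s * p))) := by
        congr 1
        rw [hrs, Real.rpow_add hWpos]
        field_simp
    _ = ENNReal.ofReal (J ^ (s * p / d)) * ENNReal.ofReal (min κ1 κ2 * W ^ p / r ^ (s * p)) :=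
        ENNReal.ofReal_mul (by positivity)
    _ ≤ _ := by gcongr

lemma ckn_center {X : Type*} [MeasurableSpace X] (μ : Measure X) (u : X → ℝ)
    (hu : Measurable u) (q : ℝ) (hq : 1 ≤ q) (c : ℝ)
    (h1 : μ univ ≤ 2 * μ {x | u x ≤ c}) (h2 : μ univ ≤ 2 * μ {x | c ≤ u x}) :
    ∫⁻ x, ENNReal.ofReal (|u x - c| ^ q) ∂μ ≤
      ENNReal.ofReal (2 ^ q * 3) * ∫⁻ x, ENNReal.ofReal (|u x| ^ q) ∂μ := by
  have hc : ENNReal.ofReal (|c| ^ q) * μ univ ≤ 2 * ∫⁻ x, ENNReal.ofReal (|u x| ^ q) ∂μ := by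
    have key : ∀ S : Set X, μ univ ≤ 2 * μ S → (∀ x ∈ S, |c| ≤ |u x|) →
        ENNReal.ofReal (|c| ^ q) * μ univ ≤ 2 * ∫⁻ x, ENNReal.ofReal (|u x| ^ q) ∂μ := by
      intro S hS hSc
      have h3 := mul_meas_ge_le_lintegral (μ := μ) (f := fun x => ENNReal.ofReal (|u x| ^ q))
        (by fun_prop) (ENNReal.ofReal (|c| ^ q))
      calc ENNReal.ofReal (|c| ^ q) * μ univ ≤ ENNReal.ofReal (|c| ^ q) * (2 * μ S) := by gcongr
        _ = 2 * (ENNReal.ofReal (|c| ^ q) * μ S) := by ring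
        _ ≤ 2 * (ENNReal.ofReal (|c| ^ q) * μ {x | ENNReal.ofReal (|c| ^ q) ≤ ENNReal.ofReal (|u x| ^ q)}) := by
            gcongr
            intro x hx
            have := hSc x hx
            simp only [mem_ofPred_eq]
            gcongr
        _ ≤ _ := by gcongr
    rcases le_total 0 c with h | h
    · refine key _ h2 fun x hx => ?_
      have hx : c ≤ u x := hx
      rw [abs_of_nonneg h, abs_of_nonneg (h.trans hx)]; exact hx
    · refine key _ h1 fun x hx => ?_
      have hx : u x ≤ c := hx
      rw [abs_of_nonpos h, abs_of_nonpos (hx.trans h)]; linarith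
  have hpt : ∀ x, |u x - c| ^ q ≤ 2 ^ q * (|u x| ^ q + |c| ^ q) := by
    intro x
    have h3 : |u x - c| ≤ 2 * max (|u x|) (|c|) := by
      have := abs_sub (u x) c
      have := le_max_left (|u x|) (|c|)
      have := le_max_right (|u x|) (|c|)
      linarith
    calc |u x - c| ^ q ≤ (2 * max (|u x|) (|c|)) ^ q := by gcongr
      _ = 2 ^ q * (max (|u x|) (|c|)) ^ q := Real.mul_rpow (by norm_num) (by positivity)
      _ ≤ _ := by
        gcongr
        rcases max_cases (|u x|) (|c|) with h | h <;> rw [h.1]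
        · have : 0 ≤ |c| ^ q := by positivity
          linarith
        · have : 0 ≤ |u x| ^ q := by positivity
          linarith
  calc ∫⁻ x, ENNReal.ofReal (|u x - c| ^ q) ∂μ
      ≤ ∫⁻ x, ENNReal.ofReal (2 ^ q) * (ENNReal.ofReal (|u x| ^ q) + ENNReal.ofReal (|c| ^ q)) ∂μ := by
        refine lintegral_mono fun x => ?_
        rw [← ENNReal.ofReal_add (by positivity) (by positivity), ← ENNReal.ofReal_mul (by positivity)]
        exact ENNReal.ofReal_le_ofReal (hpt x)
    _ = ENNReal.ofReal (2 ^ q) * ((∫⁻ x, ENNReal.ofReal (|u x| ^ q) ∂μ) + ENNReal.ofReal (|c| ^ q) * μ univ) := by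
        rw [lintegral_const_mul _ (by fun_prop), lintegral_add_right _ measurable_const, lintegral_const]
    _ ≤ ENNReal.ofReal (2 ^ q) * ((∫⁻ x, ENNReal.ofReal (|u x| ^ q) ∂μ) + 2 * ∫⁻ x, ENNReal.ofReal (|u x| ^ q) ∂μ) := by
        gcongr
    _ = _ := by
        rw [ENNReal.ofReal_mul (by positivity), show ENNReal.ofReal 3 = 3 by simp]; ring

lemma ckn_absorb (I R : ℝ≥0∞) (h0 : I ≠ 0) (hI : I ≠ ∞) (θ : ℝ) (hθ : θ < 1)
    (h : I ≤ I ^ θ * R) : I ≤ R ^ (1 / (1 - θ)) := by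
  have h1 : I ^ (1 - θ) ≤ R := by
    rw [ENNReal.rpow_sub _ _ h0 hI, ENNReal.rpow_one]
    refine ENNReal.div_le_of_le_mul ?_
    rwa [mul_comm]
  rw [one_div, ENNReal.le_rpow_inv_iff (by linarith)]
  exact h1

lemma ckn_kernel_meas {d : ℕ} (s p : ℝ) (D : Set (EuclideanSpace ℝ (Fin d)))
    (u : EuclideanSpace ℝ (Fin d) → ℝ) (hu : Measurable u) :
    Measurable fun x => ∫⁻ y in D, ENNReal.ofReal (|u x - u y| ^ p / ‖x - y‖ ^ ((d : ℝ) + s * p)) := by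
  apply Measurable.lintegral_prod_right'
    (f := fun z : EuclideanSpace ℝ (Fin d) × EuclideanSpace ℝ (Fin d) =>
      ENNReal.ofReal (|u z.1 - u z.2| ^ p / ‖z.1 - z.2‖ ^ ((d : ℝ) + s * p)))
  fun_prop

lemma ckn_local (d : ℕ) (hd : 1 ≤ d) (s p q τ a : ℝ) (hs : 0 ≤ s) (hp : 0 < p) (hq : 1 ≤ q)
    (hτ : 0 < τ) (ha : 0 < a) (ha1 : a ≤ 1)
    (hbal : 1 / τ = a * (1 / p - s / d) + (1 - a) / q)
    (c0 δ K : ℝ) (hc0 : 0 < c0) (hδ : 0 < δ) (hK : 0 < K) :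
    ∃ C > (0 : ℝ), ∀ (D : Set (EuclideanSpace ℝ (Fin d))) (L : ℝ), 0 < L → MeasurableSet D →
      volume D ≠ ∞ →
      (∀ x ∈ D, ∀ r, 0 < r → r ≤ δ * L → ∃ S ⊆ D, MeasurableSet S ∧ (∀ y ∈ S, ‖x - y‖ ≤ r) ∧
        ENNReal.ofReal (c0 * r ^ (d : ℝ)) ≤ volume S) →
      (∀ x ∈ D, ∀ y ∈ D, ‖x - y‖ ≤ K * L) →
      ∀ (u : EuclideanSpace ℝ (Fin d) → ℝ), Measurable u → ∀ M : ℝ, (∀ x, |u x| ≤ M) →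
      ∃ c : ℝ, ∫⁻ x in D, ENNReal.ofReal (|u x - c| ^ τ) ≤ ENNReal.ofReal C *
        (∫⁻ x in D, ∫⁻ y in D, ENNReal.ofReal (|u x - u y| ^ p / ‖x - y‖ ^ ((d : ℝ) + s * p))) ^ (a * τ / p)
        * (∫⁻ x in D, ENNReal.ofReal (|u x| ^ q)) ^ ((1 - a) * τ / q) := by
  have hd0 : (0 : ℝ) < d := by exact_mod_cast hd
  have hq0 : 0 < q := by linarith
  obtain ⟨κ, hκ, H⟩ := ckn_ptwise d hd s p τ hs hp hτ c0 δ K hc0 hδ hK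
  set Z : ℝ := 1 + a * τ * s / d with hZ
  have hZ1 : 1 ≤ Z := by
    have : 0 ≤ a * τ * s / d := by positivity
    linarith
  have hZ0 : 0 < Z := by linarith
  have h1a : 0 ≤ 1 - a := by linarith
  set μ : ℝ := a * τ / p / Z with hμ
  set ν : ℝ := (1 - a) * τ / q / Z with hν
  have hμ0 : 0 < μ := by positivity
  have hν0 : 0 ≤ ν := by positivity
  have hbal' : a * τ / p + (1 - a) * τ / q = Z := by
    have : τ * (1 / τ) = τ * (a * (1 / p - s / d) + (1 - a) / q) := by rw [hbal]
    rw [mul_one_div_cancel hτ.ne'] at this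
    rw [hZ]
    calc a * τ / p + (1 - a) * τ / q = τ * (a * (1 / p - s / d) + (1 - a) / q) + a * τ * s / d := by ring
      _ = _ := by rw [← this]
  have hμν : μ + ν = 1 := by
    rw [hμ, hν, ← add_div, hbal', div_self hZ0.ne']
  set N : ℝ := p + τ * s * p / d with hN
  have hN0 : 0 < N := by positivity
  have hNτ : N * μ + q * ν = τ := by
    rw [hN, hμ, hν]
    field_simp
    rw [hZ]; field_simp; ring
  set θ : ℝ := s * p / d * μ with hθ
  have hθ1 : 1 - θ = 1 / Z := by
    rw [hθ, hμ]
    field_simp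
    rw [hZ]; field_simp; ring
  have hθlt : θ < 1 := by
    have : 0 < 1 / Z := by positivity
    linarith
  refine ⟨((κ⁻¹) ^ μ * (2 ^ q * 3) ^ ν) ^ Z, by positivity, ?_⟩
  intro D L hL hD hDf hball hdiam u hu M hM
  have : IsFiniteMeasure (volume.restrict D) := ⟨by simpa using hDf.lt_top⟩
  obtain ⟨c, hc1, hc2⟩ := ckn_median (volume.restrict D) u hu M hM
  refine ⟨c, ?_⟩
  have hcen := ckn_center (volume.restrict D) u hu q hq c hc1 hc2
  set I := ∫⁻ x in D, ENNReal.ofReal (|u x - c| ^ τ) with hI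
  set G := ∫⁻ x in D, ∫⁻ y in D, ENNReal.ofReal (|u x - u y| ^ p / ‖x - y‖ ^ ((d : ℝ) + s * p)) with hG
  set Q := ∫⁻ x in D, ENNReal.ofReal (|u x| ^ q) with hQ
  by_cases hI0 : I = 0
  · rw [hI0]; exact zero_le
  have hIf : I ≠ ∞ := by
    refine ne_top_of_le_ne_top (b := ENNReal.ofReal ((M + |c|) ^ τ) * volume D)
      (ENNReal.mul_ne_top (by simp) hDf) ?_
    rw [← setLIntegral_const]
    refine lintegral_mono fun x => ?_
    have := abs_sub (u x) c
    have := hM x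
    gcongr
    linarith
  rw [Measure.restrict_apply_univ, Measure.restrict_apply' hD, inter_comm] at hc1 hc2
  have hJ0 : 0 < I.toReal := ENNReal.toReal_pos hI0 hIf
  have hpt := H D L hL hD hball hdiam u hu c hc1 hc2 I.toReal hJ0 (ENNReal.ofReal_toReal hIf)
  have hIN : ∫⁻ x in D, ENNReal.ofReal (|u x - c| ^ N) ≤
      ENNReal.ofReal κ⁻¹ * (I ^ (s * p / d) * G) := by
    have h1 : ∫⁻ x in D, ENNReal.ofReal (κ * |u x - c| ^ N) ≤ I ^ (s * p / d) * G := by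
      rw [hG, ← lintegral_const_mul _ (ckn_kernel_meas s p D u hu)]
      refine setLIntegral_mono' hD fun x hx => ?_
      have := hpt x hx
      rwa [← ENNReal.ofReal_rpow_of_pos hJ0, ENNReal.ofReal_toReal hIf] at this
    calc ∫⁻ x in D, ENNReal.ofReal (|u x - c| ^ N)
        = ENNReal.ofReal κ⁻¹ * ∫⁻ x in D, ENNReal.ofReal (κ * |u x - c| ^ N) := by
          rw [← lintegral_const_mul _ (by fun_prop)]
          refine lintegral_congr fun x => ?_
          rw [← ENNReal.ofReal_mul (by positivity), inv_mul_cancel_left₀ hκ.ne']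
      _ ≤ _ := by gcongr
  have hhol : I ≤ (∫⁻ x in D, ENNReal.ofReal (|u x - c| ^ N)) ^ μ *
      (∫⁻ x in D, ENNReal.ofReal (|u x - c| ^ q)) ^ ν := by
    refine le_trans (le_of_eq ?_) (ENNReal.lintegral_mul_norm_pow_le (by fun_prop) (by fun_prop)
      hμ0.le hν0 hμν)
    refine lintegral_congr fun x => ?_
    rw [ENNReal.ofReal_rpow_of_nonneg (by positivity) hμ0.le,
      ENNReal.ofReal_rpow_of_nonneg (by positivity) hν0, ← ENNReal.ofReal_mul (by positivity),
      ← Real.rpow_mul (by positivity), ← Real.rpow_mul (by positivity),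
      ← Real.rpow_add_of_nonneg (by positivity) (by positivity) (by positivity), hNτ]
  have hfin : I ≤ I ^ θ * (ENNReal.ofReal ((κ⁻¹) ^ μ * (2 ^ q * 3) ^ ν) * (G ^ μ * Q ^ ν)) := by
    calc I ≤ (ENNReal.ofReal κ⁻¹ * (I ^ (s * p / d) * G)) ^ μ * (ENNReal.ofReal (2 ^ q * 3) * Q) ^ ν := by
          refine hhol.trans ?_
          gcongr
      _ = _ := by
          rw [ENNReal.mul_rpow_of_nonneg _ _ hμ0.le, ENNReal.mul_rpow_of_nonneg _ _ hμ0.le,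
            ENNReal.mul_rpow_of_nonneg _ _ hν0, ← ENNReal.rpow_mul,
            ENNReal.ofReal_rpow_of_nonneg (by positivity) hμ0.le,
            ENNReal.ofReal_rpow_of_nonneg (by positivity) hν0, ENNReal.ofReal_mul (by positivity)]
          ring
  have := ckn_absorb I _ hI0 hIf θ hθlt hfin
  refine this.trans (le_of_eq ?_)
  rw [hθ1, one_div_one_div, ENNReal.mul_rpow_of_nonneg _ _ hZ0.le, ENNReal.mul_rpow_of_nonneg _ _ hZ0.le,
    ← ENNReal.rpow_mul, ← ENNReal.rpow_mul, ENNReal.ofReal_rpow_of_nonneg (by positivity) hZ0.le,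
    hμ, hν, div_mul_cancel₀ _ hZ0.ne', div_mul_cancel₀ _ hZ0.ne', mul_assoc]

/-- shells -/
def cknR (d : ℕ) (l : ℝ) (k : ℤ) : Set (EuclideanSpace ℝ (Fin d)) :=
  {x | l ^ k ≤ ‖x‖ ∧ ‖x‖ < l ^ (k + 1)}

/-- double shells -/
def cknD (d : ℕ) (l : ℝ) (k : ℤ) : Set (EuclideanSpace ℝ (Fin d)) :=
  {x | l ^ k ≤ ‖x‖ ∧ ‖x‖ < l ^ (k + 2)}

lemma cknR_meas (d : ℕ) (l : ℝ) (k : ℤ) : MeasurableSet (cknR d l k) :=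
  (measurableSet_le measurable_const measurable_norm).inter
    (measurableSet_lt measurable_norm measurable_const)

lemma cknD_meas (d : ℕ) (l : ℝ) (k : ℤ) : MeasurableSet (cknD d l k) :=
  (measurableSet_le measurable_const measurable_norm).inter
    (measurableSet_lt measurable_norm measurable_const)

lemma cknD_eq (d : ℕ) (l : ℝ) (hl : 1 < l) (k : ℤ) : cknD d l k = cknR d l k ∪ cknR d l (k + 1) := by
  have h1 : l ^ k ≤ l ^ (k + 1) := zpow_le_zpow_right₀ hl.le (by linarith)
  have h2 : l ^ (k + 1) ≤ l ^ (k + 2) := zpow_le_zpow_right₀ hl.le (by linarith)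
  ext x
  simp only [cknD, cknR, mem_union, mem_ofPred_eq, show k + 1 + 1 = k + 2 by ring]
  constructor
  · rintro ⟨h3, h4⟩
    rcases lt_or_ge ‖x‖ (l ^ (k + 1)) with h | h
    · exact Or.inl ⟨h3, h⟩
    · exact Or.inr ⟨h, h4⟩
  · rintro (⟨h3, h4⟩ | ⟨h3, h4⟩)
    · exact ⟨h3, by linarith⟩
    · exact ⟨by linarith, h4⟩

lemma cknR_disj (d : ℕ) (l : ℝ) (hl : 1 < l) : Pairwise (Function.onFun Disjoint (cknR d l)) := by
  have : ∀ j k : ℤ, j < k → Disjoint (cknR d l j) (cknR d l k) := by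
    intro j k hjk
    rw [Set.disjoint_left]
    rintro x ⟨_, h1⟩ ⟨h2, _⟩
    have h3 : l ^ (j + 1) ≤ l ^ k := zpow_le_zpow_right₀ hl.le (by linarith)
    linarith
  intro j k hjk
  rcases lt_or_gt_of_ne hjk with h | h
  · exact this j k h
  · exact (this k j h).symm

lemma cknR_iUnion (d : ℕ) (l : ℝ) (hl : 1 < l) : ⋃ k, cknR d l k = {0}ᶜ := by
  ext x
  simp only [mem_iUnion, mem_compl_iff, mem_singleton_iff]
  constructor
  · rintro ⟨k, hk, _⟩ rfl
    have : 0 < l ^ k := by positivity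
    simp at hk; linarith
  · intro hx
    obtain ⟨n, hn⟩ := _root_.exists_mem_Ico_zpow (norm_pos_iff.2 hx) hl
    exact ⟨n, hn.1, hn.2⟩

lemma cknD_fin (d : ℕ) (l : ℝ) (k : ℤ) : volume (cknD d l k) ≠ ∞ := by
  refine ne_top_of_le_ne_top (measure_ball_lt_top (x := (0 : EuclideanSpace ℝ (Fin d)))
    (r := l ^ (k + 2)) (μ := volume)).ne (measure_mono fun x hx => ?_)
  simpa using hx.2

lemma cknR_fin (d : ℕ) (l : ℝ) (k : ℤ) : volume (cknR d l k) ≠ ∞ := by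
  refine ne_top_of_le_ne_top (measure_ball_lt_top (x := (0 : EuclideanSpace ℝ (Fin d)))
    (r := l ^ (k + 1)) (μ := volume)).ne (measure_mono fun x hx => ?_)
  simpa using hx.2

open scoped Pointwise in
lemma cknR_vol (d : ℕ) (l : ℝ) (hl : 1 < l) (k : ℤ) :
    volume (cknR d l (k + 1)) = ENNReal.ofReal (l ^ (d : ℝ)) * volume (cknR d l k) := by
  have hl0 : 0 < l := by linarith
  have h : cknR d l (k + 1) = l • cknR d l k := by
    ext x
    rw [Set.mem_smul_set_iff_inv_smul_mem₀ hl0.ne']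
    simp only [cknR, mem_ofPred_eq, norm_smul, norm_inv, Real.norm_eq_abs, abs_of_pos hl0]
    rw [zpow_add₀ hl0.ne' (k+1), zpow_add₀ hl0.ne' k, zpow_one, ← div_eq_inv_mul, le_div_iff₀ hl0,
      div_lt_iff₀ hl0]
  rw [h, Measure.addHaar_smul, finrank_euclideanSpace, Fintype.card_fin, abs_of_pos (by positivity),
    Real.rpow_natCast]

lemma cknD_diam (d : ℕ) (l : ℝ) (hl : 1 < l) (k : ℤ) (x y : EuclideanSpace ℝ (Fin d))
    (hx : x ∈ cknD d l k) (hy : y ∈ cknD d l k) : ‖x - y‖ ≤ 2 * l ^ 2 * l ^ k := by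
  have hl0 : 0 < l := by linarith
  have h1 := norm_sub_le x y
  have h2 := hx.2
  have h3 := hy.2
  rw [zpow_add₀ hl0.ne'] at h2 h3
  norm_cast at h2 h3
  linarith

lemma cknD_ball (d : ℕ) (l : ℝ) (hl : 1 < l) :
    ∃ c0 > (0 : ℝ), ∀ k : ℤ, ∀ x ∈ cknD d l k, ∀ r, 0 < r → r ≤ (l ^ 2 - 1) / 2 * l ^ k →
      ∃ S ⊆ cknD d l k, MeasurableSet S ∧ (∀ y ∈ S, ‖x - y‖ ≤ r) ∧
        ENNReal.ofReal (c0 * r ^ (d : ℝ)) ≤ volume S := by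
  have hl0 : 0 < l := by linarith
  set V := volume (Metric.ball (0 : EuclideanSpace ℝ (Fin d)) 1) with hV
  have hV0 : V ≠ 0 := (Metric.measure_ball_pos _ _ one_pos).ne'
  have hVf : V ≠ ∞ := measure_ball_lt_top.ne
  have hVr : 0 < V.toReal := ENNReal.toReal_pos hV0 hVf
  refine ⟨V.toReal / 2 ^ d, by positivity, ?_⟩
  intro k x hx r hr hrL
  have hk : 0 < l ^ k := by positivity
  have hxpos : 0 < ‖x‖ := hk.trans_le hx.1
  have hx2 := hx.2
  have hk2 : l ^ (k + 2) = l ^ 2 * l ^ k := by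
    rw [zpow_add₀ hl0.ne', mul_comm]; norm_cast
  have hgen : ∀ e : ℝ, |e| = r / 2 → 0 ≤ ‖x‖ + e → l ^ k ≤ ‖x‖ + e - r / 2 →
      ‖x‖ + e + r / 2 ≤ l ^ (k + 2) → ∃ S ⊆ cknD d l k, MeasurableSet S ∧ (∀ y ∈ S, ‖x - y‖ ≤ r) ∧
        ENNReal.ofReal (V.toReal / 2 ^ d * r ^ (d : ℝ)) ≤ volume S := by
    intro e he h0 h1 h2
    set z := ((‖x‖ + e) / ‖x‖) • x with hz
    have hzn : ‖z‖ = ‖x‖ + e := by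
      rw [hz, norm_smul, Real.norm_eq_abs, abs_of_nonneg (by positivity)]
      field_simp
    have hzx : ‖x - z‖ = r / 2 := by
      have : x - z = (-(e / ‖x‖)) • x := by
        rw [hz, add_div, div_self hxpos.ne', add_smul, one_smul, neg_smul]; abel
      rw [this, norm_smul, norm_neg, norm_div, norm_norm, Real.norm_eq_abs, he]
      field_simp
    refine ⟨Metric.ball z (r / 2), ?_, measurableSet_ball, ?_, ?_⟩
    · intro y hy
      rw [mem_ball_iff_norm] at hy
      have h3 := norm_sub_norm_le y z
      have h4 := norm_sub_norm_le z y
      rw [norm_sub_rev] at h4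
      exact ⟨by linarith, by linarith⟩
    · intro y hy
      rw [mem_ball_iff_norm, norm_sub_rev] at hy
      have : ‖x - y‖ ≤ ‖x - z‖ + ‖z - y‖ := norm_sub_le_norm_sub_add_norm_sub _ _ _
      linarith
    · rw [Measure.addHaar_ball_of_pos _ _ (by positivity), finrank_euclideanSpace, Fintype.card_fin, ← hV]
      conv_rhs => rw [← ENNReal.ofReal_toReal hVf]
      rw [← ENNReal.ofReal_mul (by positivity)]
      apply le_of_eq
      congr 1
      rw [Real.rpow_natCast, div_pow]; ring
  by_cases hc : ‖x‖ + r ≤ l ^ (k + 2)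
  · exact hgen (r / 2) (abs_of_pos (by positivity)) (by positivity) (by linarith [hx.1]) (by linarith)
  · push Not at hc
    refine hgen (-(r / 2)) (by rw [abs_neg, abs_of_pos (by positivity)]) ?_ ?_ ?_ <;> nlinarith [hx.1]

lemma ckn_sum_disj {X : Type*} [MeasurableSpace X] (μ : Measure X) (A : ℤ → Set X)
    (hA : ∀ k, MeasurableSet (A k)) (hdis : Pairwise (Function.onFun Disjoint A)) (F : X → ℝ≥0∞)
    (T : Finset ℤ) : ∑ k ∈ T, ∫⁻ x in A k, F x ∂μ ≤ ∫⁻ x, F x ∂μ := by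
  rw [← lintegral_biUnion_finset (fun i _ j _ hij => hdis hij) (fun b _ => hA b)]
  exact setLIntegral_le_lintegral _ _

lemma cknD_sum (d : ℕ) (l : ℝ) (hl : 1 < l) (F : EuclideanSpace ℝ (Fin d) → ℝ≥0∞) (T : Finset ℤ) :
    ∑ k ∈ T, ∫⁻ x in cknD d l k, F x ≤ 2 * ∫⁻ x, F x := by
  calc ∑ k ∈ T, ∫⁻ x in cknD d l k, F x
      ≤ ∑ k ∈ T, ((∫⁻ x in cknR d l k, F x) + ∫⁻ x in cknR d l (k + 1), F x) := by
        refine Finset.sum_le_sum fun k _ => ?_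
        rw [cknD_eq d l hl]
        exact lintegral_union_le _ _ _
    _ = (∑ k ∈ T, ∫⁻ x in cknR d l k, F x) + ∑ k ∈ T, ∫⁻ x in cknR d l (k + 1), F x :=
        Finset.sum_add_distrib
    _ ≤ (∫⁻ x, F x) + ∫⁻ x, F x := by
        gcongr
        · exact ckn_sum_disj _ _ (cknR_meas d l) (cknR_disj d l hl) F T
        · exact ckn_sum_disj _ (fun k => cknR d l (k + 1)) (fun k => cknR_meas d l (k + 1))
            (fun i j hij => cknR_disj d l hl (by simpa using hij)) F T
    _ = _ := (two_mul _).symm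

lemma ckn_sum_rpow {ι : Type*} (T : Finset ι) (x : ι → ℝ≥0∞) (P : ℝ) (hP : 1 ≤ P) :
    ∑ i ∈ T, x i ^ P ≤ (∑ i ∈ T, x i) ^ P := by
  classical
  induction T using Finset.induction_on with
  | empty => simp
  | insert i T hi ih =>
    rw [Finset.sum_insert hi, Finset.sum_insert hi]
    refine le_trans ?_ (ENNReal.add_rpow_le_rpow_add _ _ hP)
    gcongr

lemma ckn_sum_holder {ι : Type*} (T : Finset ι) (x y : ι → ℝ≥0∞) (A B : ℝ) (hA : 0 ≤ A)
    (hB : 0 ≤ B) (hAB : 1 ≤ A + B) :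
    ∑ i ∈ T, x i ^ A * y i ^ B ≤ (∑ i ∈ T, x i) ^ A * (∑ i ∈ T, y i) ^ B := by
  have h0 : 0 < A + B := by linarith
  have h1 : ∑ i ∈ T, x i ^ (A / (A + B)) * y i ^ (B / (A + B)) ≤
      (∑ i ∈ T, x i) ^ (A / (A + B)) * (∑ i ∈ T, y i) ^ (B / (A + B)) := by
    let _ : MeasurableSpace ι := ⊤
    have := ENNReal.lintegral_mul_norm_pow_le (μ := ∑ i ∈ T, Measure.dirac i) (f := x) (g := y)
      (Measurable.aemeasurable fun _ _ => trivial) (Measurable.aemeasurable fun _ _ => trivial)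
      (p := A / (A + B)) (q := B / (A + B)) (by positivity) (by positivity) (by field_simp)
    simpa [lintegral_finsetSum_measure] using this
  calc ∑ i ∈ T, x i ^ A * y i ^ B
      = ∑ i ∈ T, (x i ^ (A / (A + B)) * y i ^ (B / (A + B))) ^ (A + B) := by
        refine Finset.sum_congr rfl fun i _ => ?_
        rw [ENNReal.mul_rpow_of_nonneg _ _ h0.le, ← ENNReal.rpow_mul, ← ENNReal.rpow_mul,
          div_mul_cancel₀ _ h0.ne', div_mul_cancel₀ _ h0.ne']
    _ ≤ (∑ i ∈ T, x i ^ (A / (A + B)) * y i ^ (B / (A + B))) ^ (A + B) := ckn_sum_rpow _ _ _ hAB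
    _ ≤ ((∑ i ∈ T, x i) ^ (A / (A + B)) * (∑ i ∈ T, y i) ^ (B / (A + B))) ^ (A + B) := by gcongr
    _ = _ := by
        rw [ENNReal.mul_rpow_of_nonneg _ _ h0.le, ← ENNReal.rpow_mul, ← ENNReal.rpow_mul,
          div_mul_cancel₀ _ h0.ne', div_mul_cancel₀ _ h0.ne']

lemma ckn_weight (d : ℕ) (l : ℝ) (hl : 1 < l) (k : ℤ) (x : EuclideanSpace ℝ (Fin d))
    (hx : x ∈ cknD d l k) (m : ℝ) :
    ‖x‖ ^ m ≤ (l ^ 2) ^ |m| * (l ^ k) ^ m ∧ (l ^ k) ^ m ≤ (l ^ 2) ^ |m| * ‖x‖ ^ m := by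
  have hl0 : 0 < l := by linarith
  have hk : 0 < l ^ k := by positivity
  have hx0 : 0 < ‖x‖ := hk.trans_le hx.1
  set t := ‖x‖ / l ^ k with ht
  have ht1 : 1 ≤ t := by rw [ht, le_div_iff₀ hk]; linarith [hx.1]
  have ht2 : t ≤ l ^ 2 := by
    have h3 := hx.2
    rw [zpow_add₀ hl0.ne'] at h3
    norm_cast at h3
    rw [ht, div_le_iff₀ hk]; linarith
  have hgen : ∀ m' : ℝ, m' ≤ |m| → t ^ m' ≤ (l ^ 2) ^ |m| := fun m' hm' =>
    (Real.rpow_le_rpow_of_exponent_le ht1 hm').trans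
      (Real.rpow_le_rpow (by linarith) ht2 (abs_nonneg _))
  have hxt : ‖x‖ = t * l ^ k := by rw [ht]; field_simp
  have ht0 : 0 < t := by linarith
  rw [hxt, Real.mul_rpow ht0.le hk.le]
  have hkm : 0 < (l ^ k) ^ m := by positivity
  constructor
  · gcongr; exact hgen m (le_abs_self _)
  · have h1 := hgen (-m) (neg_le_abs _)
    rw [Real.rpow_neg ht0.le] at h1
    have htm : 0 < t ^ m := by positivity
    have h2 : 1 ≤ (l ^ 2) ^ |m| * t ^ m := by
      rwa [inv_le_iff_one_le_mul₀ htm] at h1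
    nlinarith

lemma ckn_shift (b : ℝ) (hb0 : 0 ≤ b) (hb : b < 1) (τ : ℝ) (hτ : 1 ≤ τ) (Y e : ℤ → ℝ≥0∞)
    (hrec : ∀ k, Y k ≤ ENNReal.ofReal b * Y (k + 1) + e k) (K : ℤ) (hK : ∀ k, K < k → Y k = 0)
    (hf : ∀ k, Y k ≠ ∞) (F : ℝ≥0∞) (hF : ∀ T : Finset ℤ, (∑ k ∈ T, e k ^ τ) ^ (1 / τ) ≤ F)
    (T : Finset ℤ) : (∑ k ∈ T, Y k ^ τ) ^ (1 / τ) ≤ ENNReal.ofReal (1 / (1 - b)) * F := by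
  have hτ0 : 0 < τ := by linarith
  obtain ⟨m, hm⟩ : ∃ m : ℤ, ∀ k ∈ T, m ≤ k := by
    obtain ⟨m, hm⟩ := T.bddBelow
    exact ⟨m, fun k hk => hm hk⟩
  set U := Finset.Icc m K with hU
  have hsub : ∑ k ∈ T, Y k ^ τ ≤ ∑ k ∈ U, Y k ^ τ := by
    refine Finset.sum_le_sum_of_ne_zero fun k hk hne => ?_
    rw [hU, Finset.mem_Icc]
    refine ⟨hm k hk, ?_⟩
    by_contra h
    push Not at h
    rw [hK k h, ENNReal.zero_rpow_of_pos hτ0] at hne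
    exact hne rfl
  have hshift : ∑ k ∈ U, Y (k + 1) ^ τ ≤ ∑ k ∈ U, Y k ^ τ := by
    have : ∑ k ∈ U, Y (k + 1) ^ τ = ∑ k ∈ U.map (addRightEmbedding 1), Y k ^ τ := by
      rw [Finset.sum_map]; rfl
    rw [this]
    refine Finset.sum_le_sum_of_ne_zero fun k hk hne => ?_
    simp only [hU, Finset.mem_map, Finset.mem_Icc, addRightEmbedding_apply] at hk ⊢
    obtain ⟨j, hj, rfl⟩ := hk
    refine ⟨by linarith [hj.1], ?_⟩
    by_contra h
    push Not at h
    rw [hK _ h, ENNReal.zero_rpow_of_pos hτ0] at hne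
    exact hne rfl
  set Z := (∑ k ∈ U, Y k ^ τ) ^ (1 / τ) with hZ
  have hZf : Z ≠ ∞ := by
    refine ENNReal.rpow_ne_top_of_nonneg (by positivity) ?_
    exact (ENNReal.sum_lt_top.2 fun k _ => (ENNReal.rpow_ne_top_of_nonneg hτ0.le (hf k)).lt_top).ne
  have h1 : Z ≤ ENNReal.ofReal b * Z + F := by
    calc Z ≤ (∑ k ∈ U, (ENNReal.ofReal b * Y (k + 1) + e k) ^ τ) ^ (1 / τ) := by
          rw [hZ]
          gcongr with k _
          exact hrec k
      _ ≤ (∑ k ∈ U, (ENNReal.ofReal b * Y (k + 1)) ^ τ) ^ (1 / τ) + (∑ k ∈ U, e k ^ τ) ^ (1 / τ) :=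
          ENNReal.Lp_add_le _ _ _ hτ
      _ ≤ ENNReal.ofReal b * Z + F := by
          gcongr
          · simp_rw [ENNReal.mul_rpow_of_nonneg _ _ hτ0.le]
            rw [← Finset.mul_sum, ENNReal.mul_rpow_of_nonneg _ _ (by positivity), ← ENNReal.rpow_mul,
              mul_one_div_cancel hτ0.ne', ENNReal.rpow_one, hZ]
            gcongr
          · exact hF U
  have h2 : Z ≤ ENNReal.ofReal (1 / (1 - b)) * F := by
    by_cases hFt : F = ∞
    · rw [hFt, ENNReal.mul_top]
      · exact le_top
      · simp; linarith
    rw [← ENNReal.ofReal_toReal hZf, ← ENNReal.ofReal_toReal hFt] at h1 ⊢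
    rw [← ENNReal.ofReal_mul hb0, ← ENNReal.ofReal_add (by positivity) (by positivity),
      ENNReal.ofReal_le_ofReal_iff (by positivity)] at h1
    have : 0 ≤ 1 / (1 - b) := by
      have : 0 < 1 - b := by linarith
      positivity
    rw [← ENNReal.ofReal_mul this]
    apply ENNReal.ofReal_le_ofReal
    rw [one_div, ← div_eq_inv_mul, le_div_iff₀ (by linarith)]
    linarith
  refine le_trans ?_ h2
  rw [hZ]
  gcongr

lemma ckn_rec (d : ℕ) (hd : 1 ≤ d) (l : ℝ) (hl : 1 < l) (τ : ℝ) (hτ : 1 ≤ τ) (k : ℤ)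
    (u : EuclideanSpace ℝ (Fin d) → ℝ) (hu : Measurable u) (c : ℝ) :
    (∫⁻ x in cknR d l k, ENNReal.ofReal (|u x| ^ τ)) ^ (1 / τ) ≤
      ENNReal.ofReal (l ^ (-(d / τ))) * (∫⁻ x in cknR d l (k + 1), ENNReal.ofReal (|u x| ^ τ)) ^ (1 / τ) +
      2 * (∫⁻ x in cknD d l k, ENNReal.ofReal (|u x - c| ^ τ)) ^ (1 / τ) := by
  have hτ0 : 0 < τ := by linarith
  have hl0 : 0 < l := by linarith
  have hpow : ∀ t : ℝ, 0 ≤ t → ENNReal.ofReal (t ^ τ) = ENNReal.ofReal t ^ τ := fun t ht =>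
    (ENNReal.ofReal_rpow_of_nonneg ht hτ0.le).symm
  -- Minkowski on a set
  have mink : ∀ (A : Set (EuclideanSpace ℝ (Fin d))) (f g h : EuclideanSpace ℝ (Fin d) → ℝ), Measurable g →
      Measurable h → (∀ x, |f x| ≤ |g x| + |h x|) →
      (∫⁻ x in A, ENNReal.ofReal (|f x| ^ τ)) ^ (1 / τ) ≤
      (∫⁻ x in A, ENNReal.ofReal (|g x| ^ τ)) ^ (1 / τ) + (∫⁻ x in A, ENNReal.ofReal (|h x| ^ τ)) ^ (1 / τ) := by
    intro A f g h hg hh hfgh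
    have := ENNReal.lintegral_Lp_add_le (μ := volume.restrict A) (f := fun x => ENNReal.ofReal |g x|)
      (g := fun x => ENNReal.ofReal |h x|) (by fun_prop) (by fun_prop) hτ
    simp_rw [hpow _ (abs_nonneg _)]
    refine le_trans ?_ this
    gcongr with x
    simp only [Pi.add_apply]
    rw [← ENNReal.ofReal_add (by positivity) (by positivity)]
    exact ENNReal.ofReal_le_ofReal (hfgh x)
  have hconst : ∀ A : Set (EuclideanSpace ℝ (Fin d)),
      (∫⁻ x in A, ENNReal.ofReal (|c| ^ τ)) ^ (1 / τ) = ENNReal.ofReal |c| * volume A ^ (1 / τ) := by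
    intro A
    rw [setLIntegral_const, ENNReal.mul_rpow_of_nonneg _ _ (by positivity), hpow _ (abs_nonneg _),
      ← ENNReal.rpow_mul, mul_one_div_cancel hτ0.ne', ENNReal.rpow_one]
  have h1 := mink (cknR d l k) u (fun x => u x - c) (fun _ => c) (by fun_prop) (by fun_prop)
    (fun x => by simpa using abs_add_le (u x - c) c)
  have h2 := mink (cknR d l (k + 1)) (fun _ => c) u (fun x => u x - c) (by fun_prop) (by fun_prop)
    (fun x => by
      have := abs_sub (u x) (u x - c)
      simpa using this)
  simp only [hconst] at h1 h2
  have hvol : volume (cknR d l k) ^ (1 / τ) =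
      ENNReal.ofReal (l ^ (-(d / τ))) * volume (cknR d l (k + 1)) ^ (1 / τ) := by
    rw [cknR_vol d l hl, ENNReal.mul_rpow_of_nonneg _ _ (by positivity),
      ENNReal.ofReal_rpow_of_nonneg (by positivity) (by positivity), ← mul_assoc,
      ← ENNReal.ofReal_mul (by positivity), ← Real.rpow_mul hl0.le, ← Real.rpow_add hl0]
    rw [show -((d : ℝ) / τ) + d * (1 / τ) = 0 by ring]
    simp
  have hle1 : ENNReal.ofReal (l ^ (-(d / τ))) ≤ 1 := by
    rw [ENNReal.ofReal_le_one]
    exact Real.rpow_le_one_of_one_le_of_nonpos hl.le (by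
      have : 0 ≤ (d : ℝ) / τ := by positivity
      linarith)
  have hs1 : cknR d l k ⊆ cknD d l k := by rw [cknD_eq d l hl]; exact subset_union_left
  have hs2 : cknR d l (k + 1) ⊆ cknD d l k := by rw [cknD_eq d l hl]; exact subset_union_right
  have hm1 : (∫⁻ x in cknR d l k, ENNReal.ofReal (|u x - c| ^ τ)) ^ (1 / τ) ≤
     (∫⁻ x in cknD d l k, ENNReal.ofReal (|u x - c| ^ τ)) ^ (1 / τ) := by
    gcongr
  have hm2 : (∫⁻ x in cknR d l (k + 1), ENNReal.ofReal (|u x - c| ^ τ)) ^ (1 / τ) ≤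
     (∫⁻ x in cknD d l k, ENNReal.ofReal (|u x - c| ^ τ)) ^ (1 / τ) := by
    gcongr
  set X := (∫⁻ x in cknD d l k, ENNReal.ofReal (|u x - c| ^ τ)) ^ (1 / τ)
  set b := ENNReal.ofReal (l ^ (-(d / τ)))
  set Y := (∫⁻ x in cknR d l (k + 1), ENNReal.ofReal (|u x| ^ τ)) ^ (1 / τ)
  calc _ ≤ _ := h1
    _ ≤ X + ENNReal.ofReal |c| * (b * volume (cknR d l (k + 1)) ^ (1 / τ)) := by
        rw [← hvol]; gcongr
    _ = X + b * (ENNReal.ofReal |c| * volume (cknR d l (k + 1)) ^ (1 / τ)) := by ring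
    _ ≤ X + b * (Y + X) := by
        gcongr
        exact h2.trans (by gcongr)
    _ = b * Y + (X + b * X) := by ring
    _ ≤ b * Y + (X + 1 * X) := by gcongr
    _ = b * Y + 2 * X := by ring

lemma ckn_bdd (d : ℕ) (hd : 1 ≤ d) (s p q τ a α β γ Λ : ℝ) (hs : 0 ≤ s) (hp : 1 < p) (hq : 1 ≤ q)
    (hτ : 1 ≤ τ) (ha : 0 < a) (ha1 : a ≤ 1)
    (hγ : γ = a * α + (1 - a) * β)
    (hbal : 1 / τ = a * (1 / p - s / d) + (1 - a) / q)
    (hpos : 0 < 1 / τ + γ / d) (hΛ : 1 < Λ) :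
    ∃ C > (0 : ℝ), ∀ u : EuclideanSpace ℝ (Fin d) → ℝ, Measurable u → ∀ M ρ : ℝ,
      (∀ x, |u x| ≤ M) → (∀ x, ρ < ‖x‖ → u x = 0) →
      weightedLnorm d γ τ u ≤
        ENNReal.ofReal C * (truncGagliardo d s p α Λ u) ^ a *
          (weightedLnorm d β q u) ^ (1 - a) := by
  have hd0 : (0 : ℝ) < d := by exact_mod_cast hd
  have hq0 : 0 < q := by linarith
  have hp0 : 0 < p := by linarith
  have hτ0 : 0 < τ := by linarith
  have h1a : 0 ≤ 1 - a := by linarith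
  set l := Real.sqrt Λ with hl_def
  have hl : 1 < l := by rw [hl_def, Real.lt_sqrt (by norm_num)]; simpa using hΛ
  have hl0 : 0 < l := by linarith
  have hl2 : l ^ 2 = Λ := Real.sq_sqrt (by linarith)
  obtain ⟨c0, hc0, hball⟩ := cknD_ball d l hl
  have hδ : 0 < (l ^ 2 - 1) / 2 := by rw [hl2]; linarith
  obtain ⟨C1, hC1, hloc⟩ := ckn_local d hd s p q τ a hs hp0 hq hτ0 ha ha1 hbal c0 ((l ^ 2 - 1) / 2)
    (2 * l ^ 2) hc0 hδ (by positivity)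
  set A := a * τ / p with hA
  set B := (1 - a) * τ / q with hB
  have hA0 : 0 < A := by positivity
  have hB0 : 0 ≤ B := by positivity
  have hAB : 1 ≤ A + B := by
    have h1 : τ * (1 / τ) = τ * (a * (1 / p - s / d) + (1 - a) / q) := by rw [hbal]
    rw [mul_one_div_cancel hτ0.ne'] at h1
    have h2 : A + B = τ * (a * (1 / p - s / d) + (1 - a) / q) + a * τ * s / d := by
      rw [hA, hB]; ring
    have : 0 ≤ a * τ * s / d := by positivity
    linarith
  set b := l ^ (-(d / τ) - γ) with hb
  have hb0 : 0 < b := by positivity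
  have hb1 : b < 1 := by
    refine Real.rpow_lt_one_of_one_lt_of_neg hl ?_
    have : (d : ℝ) / τ + γ = d * (1 / τ + γ / d) := by field_simp
    have : 0 < (d : ℝ) / τ + γ := by rw [this]; positivity
    linarith
  set Cα := (l ^ 2) ^ |α * p| with hCα
  set Cβ := (l ^ 2) ^ |β * q| with hCβ
  set Cγ := (l ^ 2) ^ |γ * τ| with hCγ
  have hCα0 : 0 < Cα := by positivity
  have hCβ0 : 0 < Cβ := by positivity
  have hCγ0 : 0 < Cγ := by positivity
  have h1b : 0 < 1 - b := by linarith
  refine ⟨Cγ ^ (1 / τ) * (1 / (1 - b) * (2 * (C1 * (2 * Cα) ^ A * (2 * Cβ) ^ B) ^ (1 / τ))),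
    by positivity, ?_⟩
  intro u hu M ρ hM hρ
  have hM0 : 0 ≤ M := (abs_nonneg _).trans (hM 0)
  have hck : ∀ k, ∃ c : ℝ, _ := fun k => hloc (cknD d l k) (l ^ k) (by positivity) (cknD_meas d l k)
    (cknD_fin d l k) (hball k) (fun x hx y hy => cknD_diam d l hl k x y hx hy) u hu M hM
  choose c hc using hck
  set H := ∫⁻ x : EuclideanSpace ℝ (Fin d), ∫⁻ y : EuclideanSpace ℝ (Fin d),
      ENNReal.ofReal (|u x - u y| ^ p * ‖x‖ ^ (α * p) *
        chiCut Λ ‖x‖ ‖y‖ / ‖x - y‖ ^ ((d : ℝ) + s * p)) with hH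
  set Q := ∫⁻ x : EuclideanSpace ℝ (Fin d), ENNReal.ofReal (‖x‖ ^ (β * q) * |u x| ^ q) with hQ
  set I : ℤ → ℝ≥0∞ := fun k => ∫⁻ x in cknD d l k, ENNReal.ofReal (|u x - c k| ^ τ) with hI
  set w : ℤ → ℝ → ℝ≥0∞ := fun k m => ENNReal.ofReal ((l ^ k) ^ m) with hw
  have hwmul : ∀ k m P, 0 ≤ P → (w k m) ^ P = w k (m * P) := by
    intro k m P hP
    simp only [hw]
    rw [ENNReal.ofReal_rpow_of_nonneg (by positivity) hP, ← Real.rpow_mul (by positivity)]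
  have hwadd : ∀ k m n, w k m * w k n = w k (m + n) := by
    intro k m n
    simp only [hw]
    rw [← ENNReal.ofReal_mul (by positivity), ← Real.rpow_add (by positivity)]
  set Y : ℤ → ℝ≥0∞ := fun k => w k γ * (∫⁻ x in cknR d l k, ENNReal.ofReal (|u x| ^ τ)) ^ (1 / τ) with hY
  set e : ℤ → ℝ≥0∞ := fun k => w k γ * (2 * I k ^ (1 / τ)) with he
  -- recurrence
  have hrec : ∀ k, Y k ≤ ENNReal.ofReal b * Y (k + 1) + e k := by
    intro k
    have h1 := ckn_rec d hd l hl τ hτ k u hu (c k)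
    have h2 : ENNReal.ofReal b * w (k + 1) γ = w k γ * ENNReal.ofReal (l ^ (-(d / τ))) := by
      simp only [hw, hb]
      rw [← ENNReal.ofReal_mul (by positivity), ← ENNReal.ofReal_mul (by positivity)]
      congr 1
      rw [zpow_add₀ hl0.ne', zpow_one, Real.mul_rpow (by positivity) hl0.le, Real.rpow_sub hl0]
      field_simp
    refine (mul_le_mul' le_rfl h1).trans (le_of_eq ?_)
    simp only [hY, he]
    rw [mul_add, ← mul_assoc, ← h2, mul_assoc]
  -- bound for error terms
  have hG : ∀ k, w k (α * p) * (∫⁻ x in cknD d l k, ∫⁻ y in cknD d l k,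
      ENNReal.ofReal (|u x - u y| ^ p / ‖x - y‖ ^ ((d : ℝ) + s * p))) ≤
      ENNReal.ofReal Cα * ∫⁻ x in cknD d l k, ∫⁻ y : EuclideanSpace ℝ (Fin d),
      ENNReal.ofReal (|u x - u y| ^ p * ‖x‖ ^ (α * p) *
        chiCut Λ ‖x‖ ‖y‖ / ‖x - y‖ ^ ((d : ℝ) + s * p)) := by
    intro k
    rw [← lintegral_const_mul' _ _ (by simp [hw]), ← lintegral_const_mul' _ _ (by simp)]
    refine setLIntegral_mono' (cknD_meas d l k) fun x hx => ?_
    rw [← lintegral_const_mul' _ _ (by simp [hw]), ← lintegral_const_mul' _ _ (by simp)]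
    refine le_trans (setLIntegral_mono' (cknD_meas d l k) fun y hy => ?_) (setLIntegral_le_lintegral _ _)
    have hchi : chiCut Λ ‖x‖ ‖y‖ = 1 := by
      have hx1 := hx.1
      have hx2 := hx.2
      have hy1 := hy.1
      have hy2 := hy.2
      have hk2 : l ^ (k + 2) = Λ * l ^ k := by
        rw [zpow_add₀ hl0.ne', mul_comm, ← hl2]; norm_cast
      rw [hk2] at hx2 hy2
      have hΛ0 : 0 < Λ := by linarith
      rw [chiCut, if_pos]
      constructor
      · rw [← div_eq_inv_mul, div_le_iff₀ hΛ0]; nlinarith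
      · nlinarith
    have hwt := (ckn_weight d l hl k x hx (α * p)).2
    simp only [hw]
    rw [hchi, ← ENNReal.ofReal_mul (by positivity), ← ENNReal.ofReal_mul (by positivity)]
    apply ENNReal.ofReal_le_ofReal
    calc (l ^ k) ^ (α * p) * (|u x - u y| ^ p / ‖x - y‖ ^ ((d : ℝ) + s * p))
        ≤ (Cα * ‖x‖ ^ (α * p)) * (|u x - u y| ^ p / ‖x - y‖ ^ ((d : ℝ) + s * p)) := by gcongr
      _ = _ := by ring
  have hQk : ∀ k, w k (β * q) * (∫⁻ x in cknD d l k, ENNReal.ofReal (|u x| ^ q)) ≤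
      ENNReal.ofReal Cβ * ∫⁻ x in cknD d l k, ENNReal.ofReal (‖x‖ ^ (β * q) * |u x| ^ q) := by
    intro k
    rw [← lintegral_const_mul' _ _ (by simp [hw]), ← lintegral_const_mul' _ _ (by simp)]
    refine setLIntegral_mono' (cknD_meas d l k) fun x hx => ?_
    have hwt := (ckn_weight d l hl k x hx (β * q)).2
    simp only [hw]
    rw [← ENNReal.ofReal_mul (by positivity), ← ENNReal.ofReal_mul (by positivity), ← mul_assoc]
    gcongr
  set F : ℝ≥0∞ := ENNReal.ofReal (2 * (C1 * (2 * Cα) ^ A * (2 * Cβ) ^ B) ^ (1 / τ)) *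
    ((H ^ (1 / p)) ^ a * (Q ^ (1 / q)) ^ (1 - a)) with hF
  have hFb : ∀ T : Finset ℤ, (∑ k ∈ T, e k ^ τ) ^ (1 / τ) ≤ F := by
    intro T
    have hek : ∀ k, e k ^ τ ≤ ENNReal.ofReal (2 ^ τ * C1) * ((ENNReal.ofReal Cα * ∫⁻ x in cknD d l k, ∫⁻ y : EuclideanSpace ℝ (Fin d),
      ENNReal.ofReal (|u x - u y| ^ p * ‖x‖ ^ (α * p) *
        chiCut Λ ‖x‖ ‖y‖ / ‖x - y‖ ^ ((d : ℝ) + s * p))) ^ A *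
        (ENNReal.ofReal Cβ * ∫⁻ x in cknD d l k, ENNReal.ofReal (‖x‖ ^ (β * q) * |u x| ^ q)) ^ B) := by
      intro k
      refine le_trans ?_ (mul_le_mul_right (mul_le_mul' (ENNReal.rpow_le_rpow (hG k) hA0.le)
        (ENNReal.rpow_le_rpow (hQk k) hB0)) _)
      simp only [he]
      rw [ENNReal.mul_rpow_of_nonneg _ _ hτ0.le, ENNReal.mul_rpow_of_nonneg _ _ hτ0.le,
        ← ENNReal.rpow_mul, one_div_mul_cancel hτ0.ne', ENNReal.rpow_one,
        ENNReal.mul_rpow_of_nonneg _ _ hA0.le, ENNReal.mul_rpow_of_nonneg _ _ hB0,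
        hwmul _ _ _ hτ0.le, hwmul _ _ _ hA0.le, hwmul _ _ _ hB0]
      have h1 : w k (γ * τ) = w k (α * p * A) * w k (β * q * B) := by
        rw [hwadd]
        congr 1
        rw [hγ, hA, hB]; field_simp
      have h2 : (2 : ℝ≥0∞) ^ τ = ENNReal.ofReal (2 ^ τ) := by
        rw [← ENNReal.ofReal_rpow_of_pos (by norm_num)]; simp
      rw [h1, h2, ENNReal.ofReal_mul (by positivity)]
      have h3 := hc k
      refine (mul_le_mul' le_rfl (mul_le_mul' le_rfl h3)).trans (le_of_eq ?_)
      ring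
    calc (∑ k ∈ T, e k ^ τ) ^ (1 / τ) ≤ (∑ k ∈ T, ENNReal.ofReal (2 ^ τ * C1) * ((ENNReal.ofReal Cα * ∫⁻ x in cknD d l k, ∫⁻ y : EuclideanSpace ℝ (Fin d),
          ENNReal.ofReal (|u x - u y| ^ p * ‖x‖ ^ (α * p) *
          chiCut Λ ‖x‖ ‖y‖ / ‖x - y‖ ^ ((d : ℝ) + s * p))) ^ A *
          (ENNReal.ofReal Cβ * ∫⁻ x in cknD d l k, ENNReal.ofReal (‖x‖ ^ (β * q) * |u x| ^ q)) ^ B)) ^ (1 / τ) := by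
          gcongr with k _
          exact hek k
      _ ≤ (ENNReal.ofReal (2 ^ τ * C1) * ((ENNReal.ofReal Cα * (2 * H)) ^ A * (ENNReal.ofReal Cβ * (2 * Q)) ^ B)) ^ (1 / τ) := by
          rw [← Finset.mul_sum]
          gcongr
          refine (ckn_sum_holder T _ _ A B hA0.le hB0 hAB).trans ?_
          rw [← Finset.mul_sum, ← Finset.mul_sum]
          gcongr
          · exact cknD_sum d l hl _ T
          · exact cknD_sum d l hl _ T
      _ = F := by
          have e2 : (2 : ℝ≥0∞) = ENNReal.ofReal 2 := by simp
          have hAτ : A * (1 / τ) = 1 / p * a := by rw [hA]; field_simp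
          have hBτ : B * (1 / τ) = 1 / q * (1 - a) := by rw [hB]; field_simp
          have hτ1 : 0 ≤ 1 / τ := by positivity
          rw [hF, ← mul_assoc (ENNReal.ofReal Cα), ← mul_assoc (ENNReal.ofReal Cβ), e2,
            ← ENNReal.ofReal_mul hCα0.le, ← ENNReal.ofReal_mul hCβ0.le,
            ENNReal.mul_rpow_of_nonneg _ H hA0.le, ENNReal.mul_rpow_of_nonneg _ Q hB0,
            ENNReal.ofReal_rpow_of_nonneg (by positivity) hA0.le,
            ENNReal.ofReal_rpow_of_nonneg (by positivity) hB0]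
          have : ENNReal.ofReal (2 ^ τ * C1) * (ENNReal.ofReal ((Cα * 2) ^ A) * H ^ A * (ENNReal.ofReal ((Cβ * 2) ^ B) * Q ^ B)) = ENNReal.ofReal (2 ^ τ * (C1 * (2 * Cα) ^ A * (2 * Cβ) ^ B)) * (H ^ A * Q ^ B) := by
            rw [show 2 ^ τ * (C1 * (2 * Cα) ^ A * (2 * Cβ) ^ B) = 2 ^ τ * C1 * ((Cα * 2) ^ A * (Cβ * 2) ^ B) by rw [mul_comm 2 Cα, mul_comm 2 Cβ]; ring,
              ENNReal.ofReal_mul (p := 2 ^ τ * C1) (by positivity), ENNReal.ofReal_mul (p := (Cα * 2) ^ A) (by positivity)]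
            ring
          rw [this, ENNReal.mul_rpow_of_nonneg _ _ hτ1, ENNReal.mul_rpow_of_nonneg _ _ hτ1,
            ← ENNReal.rpow_mul, ← ENNReal.rpow_mul, hAτ, hBτ, ENNReal.rpow_mul, ENNReal.rpow_mul,
            ENNReal.ofReal_rpow_of_nonneg (by positivity) hτ1, Real.mul_rpow (by positivity) (by positivity),
            ← Real.rpow_mul (by norm_num), mul_one_div_cancel hτ0.ne', Real.rpow_one]
  -- vanishing for large k
  obtain ⟨K, hK⟩ : ∃ K : ℤ, ∀ k, K < k → Y k = 0 := by
    obtain ⟨n, hn⟩ := pow_unbounded_of_one_lt ρ hl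
    refine ⟨n, fun k hk => ?_⟩
    have : ∫⁻ x in cknR d l k, ENNReal.ofReal (|u x| ^ τ) = 0 := by
      rw [← lintegral_zero (μ := volume.restrict (cknR d l k))]
      refine setLIntegral_congr_fun (cknR_meas d l k) fun x hx => ?_
      have h1 : l ^ (n : ℤ) ≤ l ^ k := zpow_le_zpow_right₀ hl.le hk.le
      rw [zpow_natCast] at h1
      rw [hρ x (by linarith [hx.1]), abs_zero, Real.zero_rpow hτ0.ne', ENNReal.ofReal_zero]
    simp only [hY]
    rw [this, ENNReal.zero_rpow_of_pos (by positivity), mul_zero]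
  have hYf : ∀ k, Y k ≠ ∞ := by
    intro k
    refine ENNReal.mul_ne_top (by simp [hw]) (ENNReal.rpow_ne_top_of_nonneg (by positivity) ?_)
    refine ne_top_of_le_ne_top (b := ENNReal.ofReal (M ^ τ) * volume (cknR d l k))
      (ENNReal.mul_ne_top (by simp) (cknR_fin d l k)) ?_
    rw [← setLIntegral_const]
    refine lintegral_mono fun x => ?_
    have := hM x
    gcongr
  have hmain := ckn_shift b hb0.le hb1 τ hτ Y e hrec K hK hYf F hFb
  have hN : ∫⁻ x : EuclideanSpace ℝ (Fin d), ENNReal.ofReal (‖x‖ ^ (γ * τ) * |u x| ^ τ) ≤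
      ENNReal.ofReal Cγ * (ENNReal.ofReal (1 / (1 - b)) * F) ^ τ := by
    have : Nonempty (Fin d) := ⟨⟨0, hd⟩⟩
    have h0 : ∫⁻ x : EuclideanSpace ℝ (Fin d), ENNReal.ofReal (‖x‖ ^ (γ * τ) * |u x| ^ τ) =
        ∑' k : ℤ, ∫⁻ x in cknR d l k, ENNReal.ofReal (‖x‖ ^ (γ * τ) * |u x| ^ τ) := by
      rw [← lintegral_iUnion (cknR_meas d l) (cknR_disj d l hl), cknR_iUnion d l hl,
        Measure.restrict_congr_set (t := univ), Measure.restrict_univ]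
      rw [ae_eq_univ]; simp
    rw [h0]
    rw [ENNReal.tsum_eq_iSup_sum]
    refine iSup_le fun T => ?_
    have h1 : ∀ k, ∫⁻ x in cknR d l k, ENNReal.ofReal (‖x‖ ^ (γ * τ) * |u x| ^ τ) ≤
        ENNReal.ofReal Cγ * Y k ^ τ := by
      intro k
      simp only [hY]
      rw [ENNReal.mul_rpow_of_nonneg _ _ hτ0.le, ← ENNReal.rpow_mul, one_div_mul_cancel hτ0.ne',
        ENNReal.rpow_one, hwmul _ _ _ hτ0.le, ← lintegral_const_mul' _ _ (by simp [hw]),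
        ← lintegral_const_mul' _ _ (by simp)]
      refine setLIntegral_mono' (cknR_meas d l k) fun x hx => ?_
      have hxD : x ∈ cknD d l k := by rw [cknD_eq d l hl]; exact Or.inl hx
      have hwt := (ckn_weight d l hl k x hxD (γ * τ)).1
      simp only [hw]
      rw [← ENNReal.ofReal_mul (by positivity), ← ENNReal.ofReal_mul (by positivity), ← mul_assoc]
      gcongr
    calc _ ≤ ∑ k ∈ T, ENNReal.ofReal Cγ * Y k ^ τ := Finset.sum_le_sum fun k _ => h1 k
      _ = ENNReal.ofReal Cγ * ∑ k ∈ T, Y k ^ τ := by rw [Finset.mul_sum]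
      _ ≤ _ := by
        gcongr
        have := hmain T
        rw [one_div, ENNReal.rpow_inv_le_iff hτ0] at this
        exact this
  calc weightedLnorm d γ τ u ≤ (ENNReal.ofReal Cγ * (ENNReal.ofReal (1 / (1 - b)) * F) ^ τ) ^ (1 / τ) := by
        unfold weightedLnorm
        gcongr
    _ = ENNReal.ofReal (Cγ ^ (1 / τ)) * (ENNReal.ofReal (1 / (1 - b)) * F) := by
        rw [ENNReal.mul_rpow_of_nonneg _ _ (by positivity), ← ENNReal.rpow_mul, mul_one_div_cancel hτ0.ne',
          ENNReal.rpow_one, ENNReal.ofReal_rpow_of_nonneg (by positivity) (by positivity)]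
    _ = _ := by
        rw [hF, ENNReal.ofReal_mul (p := Cγ ^ (1 / τ)) (by positivity), ENNReal.ofReal_mul (p := 1 / (1 - b)) (by positivity)]
        simp only [truncGagliardo, weightedLnorm]
        ring

lemma ckn_gag_mono (d : ℕ) (s p α Λ : ℝ) (hp : 1 < p) (f g : EuclideanSpace ℝ (Fin d) → ℝ)
    (h : ∀ᵐ x, ∀ᵐ y, |f x - f y| ≤ |g x - g y|) :
    truncGagliardo d s p α Λ f ≤ truncGagliardo d s p α Λ g := by
  unfold truncGagliardo
  refine ENNReal.rpow_le_rpow ?_ (by positivity)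
  refine lintegral_mono_ae ?_
  filter_upwards [h] with x hx
  refine lintegral_mono_ae ?_
  filter_upwards [hx] with y hy
  have : 0 ≤ chiCut Λ ‖x‖ ‖y‖ := by unfold chiCut; split_ifs <;> norm_num
  gcongr

lemma ckn_norm_mono (d : ℕ) (γ τ : ℝ) (hτ : 1 ≤ τ) (f g : EuclideanSpace ℝ (Fin d) → ℝ)
    (h : ∀ᵐ x, |f x| ≤ |g x|) :
    weightedLnorm d γ τ f ≤ weightedLnorm d γ τ g := by
  unfold weightedLnorm
  refine ENNReal.rpow_le_rpow ?_ (by positivity)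
  refine lintegral_mono_ae ?_
  filter_upwards [h] with x hx
  gcongr

lemma ckn_case1 (d : ℕ) (hd : 1 ≤ d) (s p q τ a α β γ Λ : ℝ) (hs : 0 ≤ s) (hp : 1 < p) (hq : 1 ≤ q)
    (hτ : 1 ≤ τ) (ha : 0 < a) (ha1 : a ≤ 1)
    (hγ : γ = a * α + (1 - a) * β)
    (hbal : 1 / τ = a * (1 / p - s / d) + (1 - a) / q)
    (hpos : 0 < 1 / τ + γ / d) (hΛ : 1 < Λ) :
    ∃ C > (0 : ℝ), ∀ u : EuclideanSpace ℝ (Fin d) → ℝ, AEMeasurable u volume → ∀ ρ : ℝ,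
      (∀ x, ρ < ‖x‖ → u x = 0) →
      weightedLnorm d γ τ u ≤
        ENNReal.ofReal C * (truncGagliardo d s p α Λ u) ^ a *
          (weightedLnorm d β q u) ^ (1 - a) := by
  obtain ⟨C, hC, hmain⟩ := ckn_bdd d hd s p q τ a α β γ Λ hs hp hq hτ ha ha1 hγ hbal hpos hΛ
  refine ⟨C, hC, fun u hu ρ hρ => ?_⟩
  have ha1' : 0 ≤ 1 - a := by linarith
  set v := hu.mk u with hv
  have hvm : Measurable v := hu.measurable_mk
  have hvu : ∀ᵐ x, u x = v x := hu.ae_eq_mk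
  set w : ℕ → EuclideanSpace ℝ (Fin d) → ℝ := fun n x => if ‖x‖ ≤ ρ then min |v x| n else 0 with hw
  have hwm : ∀ n, Measurable (w n) := fun n =>
    Measurable.ite (measurableSet_le (by fun_prop) (by fun_prop)) (by fun_prop) measurable_const
  have hw0 : ∀ n x, 0 ≤ w n x := by
    intro n x; simp only [hw]; split_ifs
    · positivity
    · exact le_rfl
  have hwu : ∀ᵐ x, ∀ n, w n x = min |u x| n := by
    filter_upwards [hvu] with x hx n
    simp only [hw]
    split_ifs with h
    · rw [hx]
    · rw [hρ x (not_le.1 h)]; simp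
  have hwM : ∀ n x, |w n x| ≤ n := by
    intro n x
    rw [abs_of_nonneg (hw0 n x)]
    simp only [hw]; split_ifs
    · exact min_le_right _ _
    · positivity
  have hb : ∀ n, weightedLnorm d γ τ (w n) ≤ ENNReal.ofReal C * (truncGagliardo d s p α Λ u) ^ a *
          (weightedLnorm d β q u) ^ (1 - a) := by
    intro n
    refine (hmain (w n) (hwm n) n ρ (hwM n) ?_).trans ?_
    · intro x hx; simp [hw, not_le.2 hx]
    · have h1 : truncGagliardo d s p α Λ (w n) ≤ truncGagliardo d s p α Λ u := by
        apply ckn_gag_mono _ _ _ _ _ hp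
        filter_upwards [hwu] with x hx
        filter_upwards [hwu] with y hy
        rw [hx n, hy n]
        refine (abs_min_sub_min_le_max _ _ _ _).trans ?_
        simp only [sub_self, abs_zero]
        rw [max_eq_left (abs_nonneg _)]
        exact abs_abs_sub_abs_le _ _
      have h2 : weightedLnorm d β q (w n) ≤ weightedLnorm d β q u := by
        apply ckn_norm_mono _ _ _ hq
        filter_upwards [hwu] with x hx
        rw [hx n, abs_of_nonneg (by positivity)]
        exact min_le_left _ _
      gcongr
  have hτ0 : 0 < τ := by linarith
  unfold weightedLnorm at hb ⊢
  set R := ENNReal.ofReal C * (truncGagliardo d s p α Λ u) ^ a * ((∫⁻ x : EuclideanSpace ℝ (Fin d), ENNReal.ofReal (‖x‖ ^ (β * q) * |u x| ^ q)) ^ (1 / q)) ^ (1 - a) with hR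
  rw [one_div, ENNReal.rpow_inv_le_iff hτ0]
  calc ∫⁻ x : EuclideanSpace ℝ (Fin d), ENNReal.ofReal (‖x‖ ^ (γ * τ) * |u x| ^ τ)
      ≤ ∫⁻ x : EuclideanSpace ℝ (Fin d), ⨆ n, ENNReal.ofReal (‖x‖ ^ (γ * τ) * |w n x| ^ τ) := by
        refine lintegral_mono_ae ?_
        filter_upwards [hwu] with x hx
        obtain ⟨n, hn⟩ := exists_nat_ge |u x|
        refine le_trans ?_ (le_iSup _ n)
        rw [hx n, min_eq_left hn, abs_abs]
    _ = ⨆ n, ∫⁻ x : EuclideanSpace ℝ (Fin d), ENNReal.ofReal (‖x‖ ^ (γ * τ) * |w n x| ^ τ) := by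
        refine lintegral_iSup (fun n => ?_) ?_
        · have := hwm n
          fun_prop
        · intro m n hmn x
          have hmn' : (m : ℝ) ≤ n := by exact_mod_cast hmn
          have : w m x ≤ w n x := by
            simp only [hw]; split_ifs
            · gcongr
            · exact le_rfl
          have h0 := hw0 m x
          have h1 := hw0 n x
          simp only [abs_of_nonneg h0, abs_of_nonneg h1]
          gcongr
    _ ≤ R ^ τ := by
        refine iSup_le fun n => ?_
        have := hb n
        rwa [one_div, ENNReal.rpow_inv_le_iff hτ0] at this

lemma ckn_shift_s (d : ℕ) (s p α Λ ε : ℝ) (hp : 1 < p) (hΛ : 1 < Λ) (hε : 0 ≤ ε) (hs : 0 ≤ s - ε)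
    (u : EuclideanSpace ℝ (Fin d) → ℝ) :
    truncGagliardo d (s - ε) p (α - ε) Λ u ≤
      ENNReal.ofReal ((1 + Λ) ^ ε) * truncGagliardo d s p α Λ u := by
  have hp0 : 0 < p := by linarith
  have hK : 0 < 1 + Λ := by linarith
  unfold truncGagliardo
  rw [one_div, ENNReal.rpow_inv_le_iff hp0, ENNReal.mul_rpow_of_nonneg _ _ hp0.le,
    ENNReal.rpow_inv_rpow hp0.ne', ENNReal.ofReal_rpow_of_nonneg (by positivity) hp0.le,
    ← Real.rpow_mul hK.le]
  rw [← lintegral_const_mul' _ _ (by simp)]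
  refine lintegral_mono fun x => ?_
  rw [← lintegral_const_mul' _ _ (by simp)]
  refine lintegral_mono fun y => ?_
  rw [← ENNReal.ofReal_mul (by positivity)]
  refine ENNReal.ofReal_le_ofReal ?_
  unfold chiCut
  split_ifs with h
  · by_cases hxy : x = y
    · subst hxy
      simp [Real.zero_rpow hp0.ne']
    have hx : 0 < ‖x‖ := by
      rw [norm_pos_iff]
      rintro rfl
      have := h.2
      simp at this
      exact hxy this.symm
    have hd : 0 < ‖x - y‖ := by rw [norm_pos_iff]; exact sub_ne_zero.2 hxy
    have hle : ‖x - y‖ ≤ (1 + Λ) * ‖x‖ := by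
      have := norm_sub_le x y
      linarith [h.2]
    have h1 : ‖x - y‖ ^ (ε * p) ≤ (1 + Λ) ^ (ε * p) * ‖x‖ ^ (ε * p) := by
      rw [← Real.mul_rpow hK.le hx.le]
      gcongr
    rw [show (d : ℝ) + (s - ε) * p = (d + s * p) - ε * p by ring, show (α - ε) * p = α * p - ε * p by ring,
      Real.rpow_sub hd, Real.rpow_sub hx, mul_one, mul_one]
    have hA : 0 ≤ |u x - u y| ^ p := by positivity
    have e1 : |u x - u y| ^ p * (‖x‖ ^ (α * p) / ‖x‖ ^ (ε * p)) / (‖x - y‖ ^ ((d : ℝ) + s * p) / ‖x - y‖ ^ (ε * p))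
       = |u x - u y| ^ p * ‖x‖ ^ (α * p) / ‖x - y‖ ^ ((d : ℝ) + s * p) * (‖x - y‖ ^ (ε * p) / ‖x‖ ^ (ε * p)) := by
      field_simp
    rw [e1, mul_comm]
    gcongr
    rw [div_le_iff₀ (by positivity)]
    exact h1
  · simp

lemma ckn_w_in (d : ℕ) (hd : 1 ≤ d) (m : ℝ) (hm : 0 < m + d) :
    ∫⁻ x in Metric.ball (0 : EuclideanSpace ℝ (Fin d)) 1, ENNReal.ofReal (‖x‖ ^ m) ≠ ∞ := by
  have : Nonempty (Fin d) := ⟨⟨0, hd⟩⟩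
  have h : IntegrableOn (fun x : EuclideanSpace ℝ (Fin d) => ‖x‖ ^ m) (Metric.ball 0 1) volume := by
    rw [integrableOn_fun_norm_addHaar volume (f := fun t : ℝ => t ^ m)]
    have h1 : IntegrableOn (fun t : ℝ => t ^ (m + d - 1)) (Ioo 0 1) := by
      rw [intervalIntegral.integrableOn_Ioo_rpow_iff zero_lt_one]; linarith
    refine h1.congr_fun (fun t ht => ?_) measurableSet_Ioo
    simp only [finrank_euclideanSpace, Fintype.card_fin, smul_eq_mul]
    rw [← Real.rpow_natCast, ← Real.rpow_add ht.1, Nat.cast_sub hd]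
    congr 1; push_cast; ring
  exact h.lintegral_lt_top.ne

lemma ckn_w_out (d : ℕ) (hd : 1 ≤ d) (m : ℝ) (hm : m + d < 0) :
    ∫⁻ x in (Metric.ball (0 : EuclideanSpace ℝ (Fin d)) 1)ᶜ, ENNReal.ofReal (‖x‖ ^ m) ≠ ∞ := by
  have : Nonempty (Fin d) := ⟨⟨0, hd⟩⟩
  have h : IntegrableOn (fun x : EuclideanSpace ℝ (Fin d) => ‖x‖ ^ m) (Metric.ball 0 1)ᶜ volume := by
    rw [← integrable_indicator_iff measurableSet_ball.compl]
    have h0 : Integrable (fun x : EuclideanSpace ℝ (Fin d) => (Ici (1 : ℝ)).indicator (fun t => t ^ m) ‖x‖) volume := by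
      rw [integrable_fun_norm_addHaar volume (f := (Ici (1 : ℝ)).indicator (fun t => t ^ m))]
      have h1 : IntegrableOn (fun t : ℝ => t ^ (m + d - 1)) (Ici 1) := by
        rw [integrableOn_Ici_iff_integrableOn_Ioi, integrableOn_Ioi_rpow_iff zero_lt_one]; linarith
      have h2 : Integrable ((Ici (1 : ℝ)).indicator fun t : ℝ => t ^ (m + d - 1)) :=
        (integrable_indicator_iff measurableSet_Ici).2 h1
      refine h2.integrableOn.congr_fun (fun t ht => ?_) measurableSet_Ioi
      have ht : 0 < t := ht
      by_cases h : t ∈ Ici (1 : ℝ)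
      · simp only [finrank_euclideanSpace, Fintype.card_fin, smul_eq_mul, indicator_of_mem h]
        rw [← Real.rpow_natCast, ← Real.rpow_add ht, Nat.cast_sub hd]
        congr 1; push_cast; ring
      · simp only [indicator_of_notMem h, smul_zero]
    refine h0.congr (Filter.Eventually.of_forall fun x => ?_)
    by_cases h : 1 ≤ ‖x‖
    · simp [indicator, h]
    · simp [indicator, h]
  exact h.lintegral_lt_top.ne

lemma ckn_w_scale (d : ℕ) (m ρ : ℝ) (hρ : 0 < ρ) (A B : Set (EuclideanSpace ℝ (Fin d)))
    (hA : MeasurableSet A) (hB : MeasurableSet B) (hAB : ∀ x, ρ • x ∈ B ↔ x ∈ A) :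
    ∫⁻ x in B, ENNReal.ofReal (‖x‖ ^ m) =
      ENNReal.ofReal (ρ ^ (m + d)) * ∫⁻ x in A, ENNReal.ofReal (‖x‖ ^ m) := by
  have h1 : ∫⁻ x, B.indicator (fun x => ENNReal.ofReal (‖x‖ ^ m)) x ∂(Measure.map (fun x : EuclideanSpace ℝ (Fin d) => ρ • x) volume) =
      ∫⁻ x, B.indicator (fun x => ENNReal.ofReal (‖x‖ ^ m)) (ρ • x) := by
    apply lintegral_map
    · exact Measurable.indicator (by fun_prop) hB
    · fun_prop
  have h2 := Measure.map_addHaar_smul (volume : Measure (EuclideanSpace ℝ (Fin d))) hρ.ne'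
  have h3 : ∀ x : EuclideanSpace ℝ (Fin d), B.indicator (fun x => ENNReal.ofReal (‖x‖ ^ m)) (ρ • x) =
      ENNReal.ofReal (ρ ^ m) * A.indicator (fun x => ENNReal.ofReal (‖x‖ ^ m)) x := by
    intro x
    by_cases h : x ∈ A
    · rw [indicator_of_mem h, indicator_of_mem ((hAB x).2 h), ← ENNReal.ofReal_mul (by positivity), norm_smul,
        Real.norm_of_nonneg hρ.le, Real.mul_rpow hρ.le (norm_nonneg _)]
    · rw [indicator_of_notMem h, indicator_of_notMem (fun h' => h ((hAB x).1 h')), mul_zero]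
  simp_rw [h3] at h1
  rw [h2, lintegral_smul_measure, lintegral_const_mul' _ _ (by simp), lintegral_indicator hA, lintegral_indicator hB] at h1
  rw [finrank_euclideanSpace, Fintype.card_fin, abs_of_pos (by positivity), smul_eq_mul] at h1
  rw [Real.rpow_add hρ, mul_comm (ρ ^ m), ENNReal.ofReal_mul (by positivity), mul_assoc, ← h1, ← mul_assoc,
    ← ENNReal.ofReal_mul (by positivity), Real.rpow_natCast, mul_inv_cancel₀ (by positivity)]
  simp

lemma ckn_holder_set (d : ℕ) (hd : 1 ≤ d) (γ γ' τ τ' m : ℝ) (hτ : 1 ≤ τ) (hττ : τ < τ')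
    (hm : m * (1 - τ / τ') = (γ - γ') * τ)
    (u : EuclideanSpace ℝ (Fin d) → ℝ) (hu : AEMeasurable u volume)
    (A : Set (EuclideanSpace ℝ (Fin d))) :
    (∫⁻ x in A, ENNReal.ofReal (‖x‖ ^ (γ * τ) * |u x| ^ τ)) ^ (1 / τ) ≤
      (∫⁻ x in A, ENNReal.ofReal (‖x‖ ^ m)) ^ (1 / τ - 1 / τ') * weightedLnorm d γ' τ' u := by
  have : Nonempty (Fin d) := ⟨⟨0, hd⟩⟩
  have hτ0 : 0 < τ := by linarith
  have hτ'0 : 0 < τ' := by linarith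
  have hθ1 : τ / τ' < 1 := by rw [div_lt_one hτ'0]; exact hττ
  set θ := τ / τ' with hθ
  have hθ0 : 0 < θ := by positivity
  have h1 : ∫⁻ x in A, ENNReal.ofReal (‖x‖ ^ (γ * τ) * |u x| ^ τ) ≤
      (∫⁻ x in A, ENNReal.ofReal (‖x‖ ^ m)) ^ (1 - θ) * (∫⁻ x in A, ENNReal.ofReal (‖x‖ ^ (γ' * τ') * |u x| ^ τ')) ^ θ := by
    refine le_trans (le_of_eq ?_) (ENNReal.lintegral_mul_norm_pow_le (by fun_prop)
      (by have := hu.restrict (s := A); fun_prop) (by linarith) hθ0.le (by ring))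
    refine lintegral_congr_ae ?_
    have h0 : ∀ᵐ x ∂(volume.restrict A), x ≠ (0 : EuclideanSpace ℝ (Fin d)) := by
      refine ae_restrict_of_ae ?_
      rw [ae_iff]; simp
    filter_upwards [h0] with x hx
    have hx : 0 < ‖x‖ := norm_pos_iff.2 hx
    rw [ENNReal.ofReal_rpow_of_nonneg (by positivity) (by linarith),
      ENNReal.ofReal_rpow_of_nonneg (by positivity) hθ0.le, ← ENNReal.ofReal_mul (by positivity),
      Real.mul_rpow (by positivity) (by positivity), ← Real.rpow_mul hx.le, ← Real.rpow_mul hx.le,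
      ← Real.rpow_mul (abs_nonneg _), ← mul_assoc, ← Real.rpow_add hx]
    have e1 : τ' * θ = τ := by rw [hθ]; field_simp
    rw [hm, mul_assoc, e1]
    congr 3; ring
  calc _ ≤ ((∫⁻ x in A, ENNReal.ofReal (‖x‖ ^ m)) ^ (1 - θ) * (∫⁻ x in A, ENNReal.ofReal (‖x‖ ^ (γ' * τ') * |u x| ^ τ')) ^ θ) ^ (1 / τ) :=
        ENNReal.rpow_le_rpow h1 (by positivity)
    _ = (∫⁻ x in A, ENNReal.ofReal (‖x‖ ^ m)) ^ (1 / τ - 1 / τ') * (∫⁻ x in A, ENNReal.ofReal (‖x‖ ^ (γ' * τ') * |u x| ^ τ')) ^ (1 / τ') := by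
        rw [ENNReal.mul_rpow_of_nonneg _ _ (by positivity), ← ENNReal.rpow_mul, ← ENNReal.rpow_mul]
        congr 2 <;> rw [hθ] <;> field_simp
    _ ≤ _ := by
        unfold weightedLnorm
        gcongr
        exact Measure.restrict_le_self

lemma ckn_piece (d : ℕ) (hd : 1 ≤ d) (γ γ' τ τ' κ : ℝ) (hτ : 1 ≤ τ) (hττ : τ < τ')
    (hκ : κ = γ - γ' + d * (1 / τ - 1 / τ'))
    (F : ℝ → Set (EuclideanSpace ℝ (Fin d))) (hF : ∀ ρ, MeasurableSet (F ρ))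
    (hFs : ∀ ρ, 0 < ρ → ∀ x, ρ • x ∈ F ρ ↔ x ∈ F 1)
    (hfin : ∀ m : ℝ, 0 < (m + d) * κ →
      ∫⁻ x in F 1, ENNReal.ofReal (‖x‖ ^ m) ≠ ∞) (hκ0 : κ ≠ 0) :
    ∃ C > (0 : ℝ), ∀ u : EuclideanSpace ℝ (Fin d) → ℝ, AEMeasurable u volume → ∀ ρ : ℝ, 0 < ρ →
      (∫⁻ x in F ρ, ENNReal.ofReal (‖x‖ ^ (γ * τ) * |u x| ^ τ)) ^ (1 / τ) ≤
        ENNReal.ofReal (C * ρ ^ κ) * weightedLnorm d γ' τ' u := by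
  have hτ0 : 0 < τ := by linarith
  have hτ'0 : 0 < τ' := by linarith
  have hg : 0 < 1 / τ - 1 / τ' := by
    have := one_div_lt_one_div_of_lt hτ0 hττ; linarith
  set g := 1 / τ - 1 / τ' with hgd
  set m := (γ - γ') / g with hm
  have hmd : (m + d) * g = κ := by rw [hm, hκ]; field_simp
  have hW := hfin m (by
    have : 0 < ((m + d) * κ) * g := by
      rw [mul_right_comm, hmd]; exact mul_self_pos.2 hκ0
    exact pos_of_mul_pos_left this hg.le)
  set W := (∫⁻ x in F 1, ENNReal.ofReal (‖x‖ ^ m)) ^ g with hWd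
  have hW' : W ≠ ∞ := ENNReal.rpow_ne_top_of_nonneg hg.le hW
  refine ⟨W.toReal + 1, by positivity, fun u hu ρ hρ => ?_⟩
  refine (ckn_holder_set d hd γ γ' τ τ' m hτ hττ ?_ u hu (F ρ)).trans ?_
  · have : 1 - τ / τ' = g * τ := by rw [hgd]; field_simp
    rw [this, hm]; field_simp
  · gcongr
    rw [ckn_w_scale d m ρ hρ (F 1) (F ρ) (hF 1) (hF ρ) (hFs ρ hρ), ENNReal.mul_rpow_of_nonneg _ _ hg.le,
      ENNReal.ofReal_rpow_of_nonneg (by positivity) hg.le, ← Real.rpow_mul hρ.le, hmd, mul_comm (_ + _),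
      ENNReal.ofReal_mul (by positivity)]
    gcongr
    calc W = ENNReal.ofReal W.toReal := (ENNReal.ofReal_toReal hW').symm
      _ ≤ _ := ENNReal.ofReal_le_ofReal (by linarith)

lemma ckn_split (d : ℕ) (hd : 1 ≤ d) (γ γ₁ γ₂ τ τ₁ τ₂ κ : ℝ) (hτ : 1 ≤ τ) (h1 : τ < τ₁) (h2 : τ < τ₂)
    (hκ : 0 < κ)
    (hκ1 : κ = γ - γ₁ + d * (1 / τ - 1 / τ₁)) (hκ2 : -κ = γ - γ₂ + d * (1 / τ - 1 / τ₂)) :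
    ∃ C > (0 : ℝ), ∀ u : EuclideanSpace ℝ (Fin d) → ℝ, AEMeasurable u volume → ∀ ρ : ℝ, 0 < ρ →
      weightedLnorm d γ τ u ≤
        ENNReal.ofReal (C * ρ ^ κ) * weightedLnorm d γ₁ τ₁ u +
        ENNReal.ofReal (C * ρ ^ (-κ)) * weightedLnorm d γ₂ τ₂ u := by
  obtain ⟨C1, hC1, H1⟩ := ckn_piece d hd γ γ₁ τ τ₁ κ hτ h1 hκ1 (fun ρ => Metric.ball 0 ρ)
    (fun ρ => measurableSet_ball) (fun ρ hρ x => by simp [norm_smul, abs_of_pos hρ, hρ]) (fun m hm => by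
      exact ckn_w_in d hd m (pos_of_mul_pos_left hm hκ.le)) hκ.ne'
  obtain ⟨C2, hC2, H2⟩ := ckn_piece d hd γ γ₂ τ τ₂ (-κ) hτ h2 hκ2 (fun ρ => (Metric.ball 0 ρ)ᶜ)
    (fun ρ => measurableSet_ball.compl) (fun ρ hρ x => by simp [norm_smul, abs_of_pos hρ, hρ]) (fun m hm => by
      refine ckn_w_out d hd m ?_
      by_contra h
      push Not at h
      nlinarith) (by linarith)
  refine ⟨C1 + C2, by positivity, fun u hu ρ hρ => ?_⟩
  have hτ0 : 0 < τ := by linarith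
  unfold weightedLnorm at H1 H2 ⊢
  rw [← lintegral_add_compl _ (measurableSet_ball (x := (0 : EuclideanSpace ℝ (Fin d))) (ε := ρ))]
  refine (ENNReal.rpow_add_le_add_rpow _ _ (by positivity) (by rw [div_le_one hτ0]; exact hτ)).trans ?_
  refine add_le_add ((H1 u hu ρ hρ).trans ?_) ((H2 u hu ρ hρ).trans ?_)
  · gcongr; linarith
  · gcongr; linarith

lemma ckn_opt (N N1 N2 S T : ℝ≥0∞) (a η κ C C1 : ℝ) (hC : 0 < C) (hC1 : 0 < C1) (hκ : 0 < κ)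
    (ha : 0 < a) (ha1 : a < 1) (h1 : 0 < a + η) (h2 : 0 < a - η) (h3 : a + η < 1) (h4 : a - η < 1)
    (hN1 : N1 ≤ ENNReal.ofReal C1 * S ^ (a + η) * T ^ (1 - (a + η)))
    (hN2 : N2 ≤ ENNReal.ofReal C1 * S ^ (a - η) * T ^ (1 - (a - η)))
    (hN : ∀ ρ : ℝ, 0 < ρ → N ≤ ENNReal.ofReal (C * ρ ^ κ) * N1 + ENNReal.ofReal (C * ρ ^ (-κ)) * N2) :
    N ≤ ENNReal.ofReal (2 * C * C1) * S ^ a * T ^ (1 - a) := by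
  have hz : N1 = 0 → N2 = 0 → N = 0 := by
    intro h h'
    have := hN 1 one_pos
    rw [h, h', mul_zero, mul_zero, add_zero] at this
    exact le_antisymm this zero_le
  have hc0 : ENNReal.ofReal (2 * C * C1) ≠ 0 := by
    rw [Ne, ENNReal.ofReal_eq_zero, not_le]; positivity
  by_cases hS0 : S = 0
  · rw [hS0, ENNReal.zero_rpow_of_pos h1, mul_zero, zero_mul] at hN1
    rw [hS0, ENNReal.zero_rpow_of_pos h2, mul_zero, zero_mul] at hN2
    rw [hz (le_antisymm hN1 zero_le) (le_antisymm hN2 zero_le)]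
    exact zero_le
  by_cases hT0 : T = 0
  · rw [hT0, ENNReal.zero_rpow_of_pos (by linarith), mul_zero] at hN1
    rw [hT0, ENNReal.zero_rpow_of_pos (by linarith), mul_zero] at hN2
    rw [hz (le_antisymm hN1 zero_le) (le_antisymm hN2 zero_le)]
    exact zero_le
  by_cases hS : S = ∞
  · rw [hS, ENNReal.top_rpow_of_pos ha, ENNReal.mul_top hc0, ENNReal.top_mul]
    · exact le_top
    · simp [hT0, ha1, ENNReal.rpow_eq_zero_iff]; intro h; linarith
  by_cases hT : T = ∞
  · rw [hT, ENNReal.top_rpow_of_pos (by linarith), ENNReal.mul_top]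
    · exact le_top
    · refine mul_ne_zero hc0 ?_
      simp [hS0, ENNReal.rpow_eq_zero_iff]; intro h; linarith
  set x := S.toReal with hx
  set y := T.toReal with hy
  have hx0 : 0 < x := ENNReal.toReal_pos hS0 hS
  have hy0 : 0 < y := ENNReal.toReal_pos hT0 hT
  have eS : S = ENNReal.ofReal x := (ENNReal.ofReal_toReal hS).symm
  have eT : T = ENNReal.ofReal y := (ENNReal.ofReal_toReal hT).symm
  set ρ := (y / x) ^ (η / κ) with hρ
  have hρ0 : 0 < ρ := by positivity
  have e1 : ρ ^ κ = y ^ η / x ^ η := by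
    rw [hρ, ← Real.rpow_mul (by positivity), div_mul_cancel₀ _ hκ.ne', Real.div_rpow hy0.le hx0.le]
  refine (hN ρ hρ0).trans ?_
  have k1 : ENNReal.ofReal (C * ρ ^ κ) * N1 ≤ ENNReal.ofReal (C * C1 * x ^ a * y ^ (1 - a)) := by
    refine (mul_le_mul' le_rfl hN1).trans (le_of_eq ?_)
    rw [eS, eT, ENNReal.ofReal_rpow_of_pos hx0, ENNReal.ofReal_rpow_of_pos hy0,
      ← ENNReal.ofReal_mul (by positivity), ← ENNReal.ofReal_mul (by positivity),
      ← ENNReal.ofReal_mul (by positivity), e1]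
    congr 1
    rw [show 1 - (a + η) = 1 - a - η by ring, Real.rpow_add hx0, Real.rpow_sub hy0]
    field_simp
  have k2 : ENNReal.ofReal (C * ρ ^ (-κ)) * N2 ≤ ENNReal.ofReal (C * C1 * x ^ a * y ^ (1 - a)) := by
    refine (mul_le_mul' le_rfl hN2).trans (le_of_eq ?_)
    rw [eS, eT, ENNReal.ofReal_rpow_of_pos hx0, ENNReal.ofReal_rpow_of_pos hy0,
      ← ENNReal.ofReal_mul (by positivity), ← ENNReal.ofReal_mul (by positivity),
      ← ENNReal.ofReal_mul (by positivity), Real.rpow_neg hρ0.le, e1]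
    congr 1
    rw [show 1 - (a - η) = 1 - a + η by ring, Real.rpow_add hy0, Real.rpow_sub hx0]
    field_simp
  refine (add_le_add k1 k2).trans (le_of_eq ?_)
  rw [eS, eT, ENNReal.ofReal_rpow_of_pos hx0, ENNReal.ofReal_rpow_of_pos hy0,
      ← ENNReal.ofReal_mul (by positivity), ← ENNReal.ofReal_mul (by positivity),
      ← ENNReal.ofReal_add (by positivity) (by positivity)]
  congr 1; ring

lemma ckn_const (C K a : ℝ) (hK : 0 < K) (ha : 0 ≤ a) (hC : 0 < C) (S S' T N : ℝ≥0∞) (b : ℝ)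
    (h : N ≤ ENNReal.ofReal C * S' ^ a * T ^ b) (hS : S' ≤ ENNReal.ofReal K * S) :
    N ≤ ENNReal.ofReal (C * K ^ a) * S ^ a * T ^ b := by
  calc N ≤ ENNReal.ofReal C * S' ^ a * T ^ b := h
    _ ≤ ENNReal.ofReal C * (ENNReal.ofReal K * S) ^ a * T ^ b := by gcongr
    _ = _ := by
      rw [ENNReal.mul_rpow_of_nonneg _ _ ha, ENNReal.ofReal_rpow_of_pos hK, ENNReal.ofReal_mul hC.le]
      ring

/-- one interpolation endpoint -/
lemma ckn_end (d : ℕ) (hd : 1 ≤ d) (s p q a α β Λ : ℝ) (hs : 0 ≤ s) (hp : 1 < p) (hq : 1 ≤ q)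
    (ha : 0 < a) (ha1 : a < 1)
    (hpos : 0 < a * (1 / p + (α - s) / d) + (1 - a) * (1 / q + β / d)) (hΛ : 1 < Λ) :
    ∃ C > (0 : ℝ), ∀ u : EuclideanSpace ℝ (Fin d) → ℝ, AEMeasurable u volume → ∀ ρ : ℝ,
      (∀ x, ρ < ‖x‖ → u x = 0) →
      weightedLnorm d (a * (α - s) + (1 - a) * β) (1 / (a / p + (1 - a) / q)) u ≤
        ENNReal.ofReal C * (truncGagliardo d s p α Λ u) ^ a *
          (weightedLnorm d β q u) ^ (1 - a) := by
  have hd0 : (0 : ℝ) < d := by exact_mod_cast hd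
  have hp0 : 0 < p := by linarith
  have hq0 : 0 < q := by linarith
  have hip : 1 / p ≤ 1 := by rw [div_le_one hp0]; exact hp.le
  have hiq : 1 / q ≤ 1 := by rw [div_le_one hq0]; exact hq
  have ha1' : 0 < 1 - a := by linarith
  have hi0 : 0 < a / p + (1 - a) / q := by positivity
  have hi1 : a / p + (1 - a) / q ≤ 1 := by
    have e1 : a / p = a * (1 / p) := by ring
    have e2 : (1 - a) / q = (1 - a) * (1 / q) := by ring
    rw [e1, e2]; nlinarith
  obtain ⟨C, hC, H⟩ := ckn_case1 d hd 0 p q (1 / (a / p + (1 - a) / q)) a (α - s) β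
    (a * (α - s) + (1 - a) * β) Λ le_rfl hp hq (by rw [le_div_iff₀ hi0]; linarith) ha ha1.le rfl
    (by rw [one_div_one_div]; ring) (by
      rw [one_div_one_div]
      have : a / p + (1 - a) / q + (a * (α - s) + (1 - a) * β) / d = a * (1 / p + (α - s) / d) + (1 - a) * (1 / q + β / d) := by ring
      rw [this]; exact hpos) hΛ
  refine ⟨C * ((1 + Λ) ^ s) ^ a, by positivity, fun u hu ρ hρ => ?_⟩
  refine ckn_const C ((1 + Λ) ^ s) a (by positivity) ha.le hC _ _ _ _ _ (H u hu ρ hρ) ?_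
  have := ckn_shift_s d s p α Λ s hp hΛ hs (by linarith) u
  rwa [sub_self] at this

lemma ckn_case2 (d : ℕ) (hd : 1 ≤ d) (s p q τ a α β γ σ Λ : ℝ)
    (hs : 0 < s) (hp : 1 < p) (hq : 1 ≤ q) (hτ : 1 ≤ τ)
    (ha : 0 < a) (ha1 : a ≤ 1)
    (hσ : γ = a * σ + (1 - a) * β)
    (hbal : 1 / τ + γ / d = a * (1 / p + (α - s) / d) + (1 - a) * (1 / q + β / d))
    (hgt : s < α - σ)
    (hne : 1 / τ + γ / d ≠ 1 / p + (α - s) / d)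
    (hpos : 0 < 1 / τ + γ / d) (hΛ : 1 < Λ) :
    ∃ C > (0 : ℝ), ∀ u : EuclideanSpace ℝ (Fin d) → ℝ, AEMeasurable u volume → ∀ ρ : ℝ,
      (∀ x, ρ < ‖x‖ → u x = 0) →
      weightedLnorm d γ τ u ≤
        ENNReal.ofReal C * (truncGagliardo d s p α Λ u) ^ a *
          (weightedLnorm d β q u) ^ (1 - a) := by
  have hd0 : (0 : ℝ) < d := by exact_mod_cast hd
  have hp0 : 0 < p := by linarith
  have hq0 : 0 < q := by linarith
  have hτ0 : 0 < τ := by linarith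
  set P := 1 / p + (α - s) / d with hP
  set Q := 1 / q + β / d with hQ
  have ha1 : a < 1 := by
    rcases ha1.lt_or_eq with h | h
    · exact h
    · exfalso; apply hne; rw [hbal, h]; ring
  have hPQ : P - Q ≠ 0 := by
    intro h; apply hne; rw [hbal, show Q = P by linarith]; ring
  have hgap : 0 < 1 / τ - (a / p + (1 - a) / q) := by
    have : 1 / τ - (a / p + (1 - a) / q) = a * (α - σ - s) / d := by
      have e : 1 / τ = a * P + (1 - a) * Q - γ / d := by linarith
      rw [e, hP, hQ, hσ]; ring
    rw [this]
    have : 0 < α - σ - s := by linarith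
    positivity
  set G := 1 / τ - (a / p + (1 - a) / q) with hG
  set δ := 1 / τ + γ / d with hδ
  have hab : 0 < |P - Q| := abs_pos.2 hPQ
  obtain ⟨h, hh0, hh1, hh2, hh3, hh4⟩ : ∃ h > 0, h < a ∧ h < 1 - a ∧ h < G ∧ h * |P - Q| < δ := by
    refine ⟨min (min a (1 - a)) (min G (δ / |P - Q|)) / 2, ?_, ?_⟩
    · have : 0 < 1 - a := by linarith
      positivity
    have hm : 0 < min (min a (1 - a)) (min G (δ / |P - Q|)) := by
      have : 0 < 1 - a := by linarith
      positivity
    have k1 : min (min a (1 - a)) (min G (δ / |P - Q|)) ≤ a := (min_le_left _ _).trans (min_le_left _ _)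
    have k2 : min (min a (1 - a)) (min G (δ / |P - Q|)) ≤ 1 - a := (min_le_left _ _).trans (min_le_right _ _)
    have k3 : min (min a (1 - a)) (min G (δ / |P - Q|)) ≤ G := (min_le_right _ _).trans (min_le_left _ _)
    have k4 : min (min a (1 - a)) (min G (δ / |P - Q|)) ≤ δ / |P - Q| := (min_le_right _ _).trans (min_le_right _ _)
    refine ⟨by linarith, by linarith, by linarith, ?_⟩
    rw [← lt_div_iff₀ hab]; linarith
  obtain ⟨η, hη, hηP⟩ : ∃ η : ℝ, |η| = h ∧ η * (P - Q) < 0 := by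
    rcases lt_or_gt_of_ne hPQ with h' | h'
    · exact ⟨h, abs_of_pos hh0, by nlinarith⟩
    · exact ⟨-h, by rw [abs_neg, abs_of_pos hh0], by nlinarith⟩
  have hη1 : η ≤ h := hη ▸ le_abs_self η
  have hη2 : -h ≤ η := by have := neg_abs_le η; rwa [hη] at this
  have hηδ : |η * (P - Q)| < δ := by rw [abs_mul, hη]; exact hh4
  have hηδ' := abs_lt.1 hηδ
  have hpq : |η * (1 / p - 1 / q)| < G := by
    rw [abs_mul, hη]
    have hip : 1 / p ≤ 1 := by rw [div_le_one hp0]; exact hp.le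
    have hiq : 1 / q ≤ 1 := by rw [div_le_one hq0]; exact hq
    have hip0 : 0 < 1 / p := by positivity
    have hiq0 : 0 < 1 / q := by positivity
    have : |1 / p - 1 / q| ≤ 1 := by rw [abs_le]; constructor <;> linarith
    nlinarith
  have hpq' := abs_lt.1 hpq
  have key : ∀ e : ℝ, |e| = h → -G < e * (1 / p - 1 / q) → e * (1 / p - 1 / q) < G →
      τ < 1 / ((a + e) / p + (1 - (a + e)) / q) := by
    intro e he h1 h2
    have e1 := le_abs_self e
    have e2 := neg_abs_le e
    have i1 : 0 < a + e := by linarith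
    have i2 : 0 < 1 - (a + e) := by linarith
    rw [lt_one_div hτ0 (by positivity)]
    have : (a + e) / p + (1 - (a + e)) / q = a / p + (1 - a) / q + e * (1 / p - 1 / q) := by ring
    rw [this]; linarith
  obtain ⟨C1, hC1, H1⟩ := ckn_end d hd s p q (a + η) α β Λ hs.le hp hq (by linarith) (by linarith)
    (by
      have : (a + η) * P + (1 - (a + η)) * Q = δ + η * (P - Q) := by rw [hbal]; ring
      rw [this]; linarith) hΛ
  obtain ⟨C2, hC2, H2⟩ := ckn_end d hd s p q (a - η) α β Λ hs.le hp hq (by linarith) (by linarith)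
    (by
      have : (a - η) * P + (1 - (a - η)) * Q = δ - η * (P - Q) := by rw [hbal]; ring
      rw [this]; linarith) hΛ
  have hγ : γ = d * (a * P + (1 - a) * Q - 1 / τ) := by
    have : γ / d = a * P + (1 - a) * Q - 1 / τ := by linarith
    rw [← this]; field_simp
  have hPd : α - s = d * (P - 1 / p) := by rw [hP]; field_simp; ring
  have hQd : β = d * (Q - 1 / q) := by rw [hQ]; field_simp; ring
  have hκ : 0 < -(d * (η * (P - Q))) := by
    have := mul_pos hd0 (neg_pos.2 hηP)
    linarith
  obtain ⟨C, hC, HS⟩ := ckn_split d hd γ ((a + η) * (α - s) + (1 - (a + η)) * β)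
    ((a - η) * (α - s) + (1 - (a - η)) * β) τ (1 / ((a + η) / p + (1 - (a + η)) / q))
    (1 / ((a - η) / p + (1 - (a - η)) / q)) (-(d * (η * (P - Q)))) hτ (key η hη hpq'.1 hpq'.2)
    (by
      have := key (-η) (by rwa [abs_neg]) (by linarith) (by linarith)
      rwa [← sub_eq_add_neg] at this) hκ
    (by rw [one_div_one_div, hPd, hQd, hγ]; ring)
    (by rw [one_div_one_div, hPd, hQd, hγ]; ring)
  refine ⟨2 * C * (C1 + C2), by positivity, fun u hu ρ hρ => ?_⟩
  refine ckn_opt _ _ _ _ _ a η _ C (C1 + C2) hC (by positivity) hκ ha ha1 (by linarith) (by linarith)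
    (by linarith) (by linarith) ((H1 u hu ρ hρ).trans ?_) ((H2 u hu ρ hρ).trans ?_) (HS u hu)
  · gcongr; linarith
  · gcongr; linarith

theorem fractional_CKN_improved
    (d : ℕ) (s p q τ a α β γ σ Λ : ℝ) (hd : 1 ≤ d)
    (hs : 0 < s) (hs1 : s < 1) (hp : 1 < p) (hq : 1 ≤ q) (hτ : 1 ≤ τ)
    (ha : 0 < a) (ha1 : a ≤ 1)
    (hσ : γ = a * σ + (1 - a) * β)
    (hbal : 1 / τ + γ / d = a * (1 / p + (α - s) / d) + (1 - a) * (1 / q + β / d))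
    (hrange : 0 ≤ α - σ)
    (hcrit : 1 / τ + γ / d = 1 / p + (α - s) / d → α - σ ≤ s)
    (hpos : 0 < 1 / τ + γ / d) (hΛ : 1 < Λ) :
    ∃ C > (0 : ℝ), ∀ u : EuclideanSpace ℝ (Fin d) → ℝ,
      LocallyIntegrableOn u {(0 : EuclideanSpace ℝ (Fin d))}ᶜ volume →
      HasCompactSupport u →
      weightedLnorm d γ τ u ≤
        ENNReal.ofReal C * (truncGagliardo d s p α Λ u) ^ a *
          (weightedLnorm d β q u) ^ (1 - a) := by
  have hd0 : (0 : ℝ) < d := by exact_mod_cast hd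
  have hred : ∃ C > (0 : ℝ), ∀ u : EuclideanSpace ℝ (Fin d) → ℝ, AEMeasurable u volume → ∀ ρ : ℝ,
      (∀ x, ρ < ‖x‖ → u x = 0) →
      weightedLnorm d γ τ u ≤
        ENNReal.ofReal C * (truncGagliardo d s p α Λ u) ^ a *
          (weightedLnorm d β q u) ^ (1 - a) := by
    by_cases h : α - σ ≤ s
    · obtain ⟨C, hC, H⟩ := ckn_case1 d hd (s - (α - σ)) p q τ a σ β γ Λ (by linarith) hp hq hτ ha ha1
        hσ (by
          have e : 1 / τ = a * (1 / p + (α - s) / d) + (1 - a) * (1 / q + β / d) - γ / d := by linarith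
          rw [e, hσ]; ring) hpos hΛ
      refine ⟨C * ((1 + Λ) ^ (α - σ)) ^ a, by positivity, fun u hu ρ hρ => ?_⟩
      refine ckn_const C ((1 + Λ) ^ (α - σ)) a (by positivity) ha.le hC _ _ _ _ _ (H u hu ρ hρ) ?_
      have := ckn_shift_s d s p α Λ (α - σ) hp hΛ hrange (by linarith) u
      rwa [_root_.sub_sub_cancel] at this
    · push Not at h
      exact ckn_case2 d hd s p q τ a α β γ σ Λ hs hp hq hτ ha ha1 hσ hbal h
        (fun h' => absurd (hcrit h') (not_le.2 h)) hpos hΛ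
  obtain ⟨C, hC, H⟩ := hred
  refine ⟨C, hC, fun u hu hc => ?_⟩
  have : Nonempty (Fin d) := ⟨⟨0, hd⟩⟩
  have hm : AEMeasurable u volume := by
    have h1 := hu.aestronglyMeasurable.aemeasurable
    rwa [Measure.restrict_congr_set (t := univ) (by rw [ae_eq_univ]; simp), Measure.restrict_univ] at h1
  obtain ⟨ρ, hρ⟩ := hc.isCompact.isBounded.exists_norm_le
  refine H u hm ρ fun x hx => ?_
  by_contra h
  exact absurd (hρ x (subset_tsupport _ h)) (not_le.2 hx)
end
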